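/- arXiv:2107.14748 — 2 statements merged into one kernel-verified Lean document; each statement's English description precedes it below -/
import Mathlib

section
/- Let δ > 0 and let p be a real number. Then sup_{T ≥ 1} ∫_T^{T+δ} |ζ(1+it)|^p dt < ∞ if and only if −1 < p < 1. -/
open Complex Real Filter MeasureTheory intervalIntegral

/-- The exponential sum with nonnegative coefficients `a` and frequencies `x`. -/
noncomputable def expSum (a x : ℕ → ℝ) (t : ℝ) : ℂ := ∑' n, (a n : ℂ) * cexp (-(t * x n) * I)

lemma norm_cexp_neg_mul_I (t x : ℝ) : ‖cexp (-(t * x) * I)‖ = 1 := by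
  have := Complex.norm_exp_ofReal_mul_I (-(t * x))
  push_cast at this
  exact this

lemma continuous_expSum {a : ℕ → ℝ} (ha : ∀ n, 0 ≤ a n) (hs : Summable a) (x : ℕ → ℝ) :
    Continuous (expSum a x) := by
  refine continuous_tsum (fun n ↦ by fun_prop) hs fun n t ↦ ?_
  rw [norm_mul, norm_cexp_neg_mul_I, mul_one, Complex.norm_of_nonneg (ha n)]

lemma normSq_expSum {a : ℕ → ℝ} (ha : ∀ n, 0 ≤ a n) (hs : Summable a) (x : ℕ → ℝ) (t : ℝ) :
    ((‖expSum a x t‖ ^ 2 : ℝ) : ℂ) =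
      ∑' q : ℕ × ℕ, ((a q.1 * a q.2 : ℝ) : ℂ) * cexp (-(t * (x q.1 - x q.2)) * I) := by
  have h (n) : ‖(a n : ℂ) * cexp (-(t * x n) * I)‖ = a n := by
    rw [norm_mul, norm_cexp_neg_mul_I, mul_one, Complex.norm_of_nonneg (ha n)]
  have hs1 : Summable fun n ↦ ‖(a n : ℂ) * cexp (-(t * x n) * I)‖ := by simpa only [h]
  have hs2 : Summable fun n ↦ ‖(starRingEnd ℂ) ((a n : ℂ) * cexp (-(t * x n) * I))‖ := by
    simpa only [RCLike.norm_conj]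
  push_cast
  rw [← Complex.mul_conj', expSum, Complex.conj_tsum, tsum_mul_tsum_of_summable_norm hs1 hs2]
  refine tsum_congr fun q ↦ ?_
  rw [map_mul, conj_ofReal, ← exp_conj, mul_mul_mul_comm, ← Complex.exp_add]
  simp only [map_mul, map_neg, conj_ofReal, conj_I]
  congr 2
  ring

/-- The mean square of an exponential sum with nonnegative coefficients, against a kernel which is
an autocorrelation, is largest at the origin. -/
lemma integral_normSq_expSum_le {a : ℕ → ℝ} (ha : ∀ n, 0 ≤ a n) (hs : Summable a) (x : ℕ → ℝ)
    (ν : Measure ℝ) [IsFiniteMeasure ν] (T : ℝ) :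
    ∫ z, ‖expSum a x (T + (z.1 - z.2))‖ ^ 2 ∂(ν.prod ν) ≤
      ∫ z, ‖expSum a x (z.1 - z.2)‖ ^ 2 ∂(ν.prod ν) := by
  set K : ℝ → ℂ := fun y ↦ ∫ u, cexp (-(u * y) * I) ∂ν with hK
  have key (T : ℝ) : ((∫ z, ‖expSum a x (T + (z.1 - z.2))‖ ^ 2 ∂(ν.prod ν) : ℝ) : ℂ) =
      ∑' q : ℕ × ℕ, ((a q.1 * a q.2 * ‖K (x q.1 - x q.2)‖ ^ 2 : ℝ) : ℂ) *
        cexp (-(T * (x q.1 - x q.2 : ℝ)) * I) := by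
    rw [← integral_complex_ofReal]
    simp_rw [normSq_expSum ha hs]
    rw [← integral_tsum_of_summable_integral_norm]
    · refine tsum_congr fun q ↦ ?_
      have (z : ℝ × ℝ) : ((a q.1 * a q.2 : ℝ) : ℂ) *
          cexp (-((T + (z.1 - z.2) : ℝ) * (x q.1 - x q.2)) * I) =
          (((a q.1 * a q.2 : ℝ) : ℂ) * cexp (-(T * (x q.1 - x q.2 : ℝ)) * I)) *
          (cexp (-(z.1 * (x q.1 - x q.2 : ℝ)) * I) *
            (starRingEnd ℂ) (cexp (-(z.2 * (x q.1 - x q.2 : ℝ)) * I))) := by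
        rw [← exp_conj, mul_assoc, ← Complex.exp_add, ← Complex.exp_add]
        simp only [map_mul, map_neg, conj_ofReal, conj_I]
        push_cast
        congr 2
        ring
      simp_rw [this]
      rw [MeasureTheory.integral_const_mul,
        integral_prod_mul (fun u : ℝ ↦ cexp (-(u * (x q.1 - x q.2 : ℝ)) * I))
        (fun u : ℝ ↦ (starRingEnd ℂ) (cexp (-(u * (x q.1 - x q.2 : ℝ)) * I))), integral_conj,
        Complex.mul_conj']
      simp only [hK]
      push_cast
      ring
    · intro q
      refine Integrable.of_bound (C := ‖((a q.1 * a q.2 : ℝ) : ℂ)‖) ?_ (.of_forall fun z ↦ ?_)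
      · exact Continuous.aestronglyMeasurable (by fun_prop)
      · have := norm_cexp_neg_mul_I (T + (z.1 - z.2)) (x q.1 - x q.2)
        push_cast at this ⊢
        rw [norm_mul, this, mul_one]
    · have h (q : ℕ × ℕ) (z : ℝ × ℝ) : ‖((a q.1 * a q.2 : ℝ) : ℂ) *
          cexp (-((T + (z.1 - z.2) : ℝ) * (x q.1 - x q.2)) * I)‖ = a q.1 * a q.2 := by
        have := norm_cexp_neg_mul_I (T + (z.1 - z.2)) (x q.1 - x q.2)
        push_cast at this ⊢
        rw [norm_mul, this, mul_one, norm_mul, Complex.norm_of_nonneg (ha _),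
          Complex.norm_of_nonneg (ha _)]
      simp_rw [h, MeasureTheory.integral_const]
      exact (hs.mul_of_nonneg hs ha ha).const_smul _
  have hn : 0 ≤ fun q : ℕ × ℕ ↦ a q.1 * a q.2 * ‖K (x q.1 - x q.2)‖ ^ 2 :=
    fun q ↦ mul_nonneg (mul_nonneg (ha _) (ha _)) (sq_nonneg _)
  have hsum : Summable fun q : ℕ × ℕ ↦ a q.1 * a q.2 * ‖K (x q.1 - x q.2)‖ ^ 2 := by
    refine Summable.of_nonneg_of_le hn (fun q ↦ ?_)
      ((hs.mul_of_nonneg hs ha ha).mul_right (ν.real Set.univ ^ 2))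
    have : ‖K (x q.1 - x q.2)‖ ≤ 1 * ν.real Set.univ :=
      norm_integral_le_of_norm_le_const (.of_forall fun u ↦ (norm_cexp_neg_mul_I u _).le)
    have hh := mul_nonneg (ha q.1) (ha q.2)
    rw [one_mul] at this
    gcongr
  have h0 := key 0
  simp only [ofReal_zero, zero_mul, neg_zero, Complex.exp_zero, mul_one, zero_add] at h0
  rw [← ofReal_tsum] at h0
  rw [ofReal_inj.mp h0, ← Complex.norm_of_nonneg
    (r := ∫ z, ‖expSum a x (T + (z.1 - z.2))‖ ^ 2 ∂(ν.prod ν))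
    (integral_nonneg fun _ ↦ by positivity), key T]
  have hq (q : ℕ × ℕ) : ‖((a q.1 * a q.2 * ‖K (x q.1 - x q.2)‖ ^ 2 : ℝ) : ℂ) *
      cexp (-(T * (x q.1 - x q.2 : ℝ)) * I)‖ = a q.1 * a q.2 * ‖K (x q.1 - x q.2)‖ ^ 2 := by
    rw [norm_mul, norm_cexp_neg_mul_I, mul_one, Complex.norm_of_nonneg (hn q)]
  refine (norm_tsum_le_tsum_norm (by simpa only [hq])).trans_eq (tsum_congr hq)

lemma integral_normSq_expSum_interval_le {a : ℕ → ℝ} (ha : ∀ n, 0 ≤ a n) (hs : Summable a)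
    (x : ℕ → ℝ) {δ : ℝ} (hδ : 0 < δ) (T : ℝ) :
    ∫ t in T..(T + δ), ‖expSum a x t‖ ^ 2 ≤
      2 * ∫ t in (-(2 * δ))..(2 * δ), ‖expSum a x t‖ ^ 2 := by
  set g : ℝ → ℝ := fun t ↦ ‖expSum a x t‖ ^ 2 with hg
  have hgc : Continuous g := (continuous_expSum ha hs x).norm.pow 2
  have hg0 : ∀ t, 0 ≤ g t := fun t ↦ sq_nonneg _
  have hgi (a b : ℝ) : IntervalIntegrable g volume a b := hgc.intervalIntegrable _ _
  have hbound (t) : g t ≤ (∑' n, a n) ^ 2 := by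
    have h (n) : ‖(a n : ℂ) * cexp (-(t * x n) * I)‖ = a n := by
      rw [norm_mul, norm_cexp_neg_mul_I, mul_one, Complex.norm_of_nonneg (ha n)]
    have := (norm_tsum_le_tsum_norm (by simpa only [h])).trans_eq (tsum_congr h)
    simp only [hg, expSum]
    gcongr
  have hle : 0 ≤ 2 * δ := by positivity
  set ν : Measure ℝ := volume.restrict (Set.Ioc 0 (2 * δ))
  have hprod (T : ℝ) : ∫ z, g (T + (z.1 - z.2)) ∂(ν.prod ν) =
      ∫ u in 0..(2 * δ), ∫ v in 0..(2 * δ), g (T + (u - v)) := by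
    simp_rw [intervalIntegral.integral_of_le hle]
    refine integral_prod _ (Integrable.of_bound (C := (∑' n, a n) ^ 2) ?_ (.of_forall fun z ↦ ?_))
    · exact Continuous.aestronglyMeasurable (by fun_prop)
    · rw [Real.norm_of_nonneg (hg0 _)]
      exact hbound _
  have hcont (T : ℝ) : Continuous fun u ↦ ∫ v in 0..(2 * δ), g (T + (u - v)) :=
    continuous_parametric_intervalIntegral_of_continuous' (by fun_prop) _ _
  have hnn (T u : ℝ) : 0 ≤ ∫ v in 0..(2 * δ), g (T + (u - v)) :=
    intervalIntegral.integral_nonneg hle fun v _ ↦ hg0 _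
  have hlow : δ * ∫ t in T..(T + δ), g t ≤ ∫ z, g (T + (z.1 - z.2)) ∂(ν.prod ν) := by
    rw [hprod T]
    calc δ * ∫ t in T..(T + δ), g t = ∫ u in δ..(2 * δ), ∫ t in T..(T + δ), g t := by
          rw [intervalIntegral.integral_const, smul_eq_mul]; ring
      _ ≤ ∫ u in δ..(2 * δ), ∫ v in 0..(2 * δ), g (T + (u - v)) := by
          refine intervalIntegral.integral_mono_on (by linarith) (by simp)
            ((hcont T).intervalIntegrable _ _) fun u hu ↦ ?_
          have : ∫ t in T..(T + δ), g t = ∫ v in (u - δ)..u, g (T + (u - v)) := by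
            have := intervalIntegral.integral_comp_sub_left (a := u - δ) (b := u) g (T + u)
            simp only [add_sub_assoc] at this
            rw [this]
            simp
          rw [this]
          refine intervalIntegral.integral_mono_interval (by linarith [hu.1]) (by linarith) hu.2
            (.of_forall fun v ↦ hg0 _) (Continuous.intervalIntegrable (by fun_prop) _ _)
      _ ≤ _ := intervalIntegral.integral_mono_interval hδ.le (by linarith) le_rfl
            (.of_forall fun v ↦ hnn _ _) ((hcont T).intervalIntegrable _ _)
  have hup : ∫ z, g (z.1 - z.2) ∂(ν.prod ν) ≤ 2 * δ * ∫ t in (-(2 * δ))..(2 * δ), g t := by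
    have h0 := hprod 0
    simp only [zero_add] at h0
    rw [h0]
    calc _ ≤ ∫ u in 0..(2 * δ), ∫ t in (-(2 * δ))..(2 * δ), g t := by
          refine intervalIntegral.integral_mono_on hle
            (by simpa using (hcont 0).intervalIntegrable _ _) (by simp) fun u hu ↦ ?_
          rw [intervalIntegral.integral_comp_sub_left]
          refine intervalIntegral.integral_mono_interval (by linarith [hu.1]) (by linarith)
            (by linarith [hu.2]) (.of_forall fun v ↦ hg0 _) (hgi _ _)
      _ = _ := by rw [intervalIntegral.integral_const, smul_eq_mul]; ring
  have := hlow.trans ((integral_normSq_expSum_le ha hs x ν T).trans hup)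
  have : δ * ∫ t in T..(T + δ), g t ≤ δ * (2 * ∫ t in (-(2 * δ))..(2 * δ), g t) := by
    linarith
  exact le_of_mul_le_mul_left this hδ

open ArithmeticFunction in
lemma LSeries_vonMangoldt_eq_expSum {σ : ℝ} (t : ℝ) :
    LSeries (fun n ↦ (vonMangoldt n : ℂ)) (σ + t * I) =
      expSum (fun n ↦ vonMangoldt n * (n : ℝ) ^ (-σ)) (fun n ↦ Real.log n) t := by
  rw [LSeries_def₀ (by simp), expSum]
  refine tsum_congr fun n ↦ ?_
  rcases eq_or_ne n 0 with rfl | hn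
  · simp
  have hn' : (n : ℂ) ≠ 0 := by exact_mod_cast hn
  rw [div_eq_mul_inv, ← cpow_neg, neg_add, cpow_add _ _ hn', ← mul_assoc]
  push_cast
  rw [ofReal_cpow (by positivity), Complex.cpow_def_of_ne_zero hn' (-(t * I)), ← natCast_log]
  push_cast
  congr 2
  ring

open ArithmeticFunction in
lemma summable_vonMangoldt_mul_rpow {σ : ℝ} (hσ : 1 < σ) :
    Summable fun n : ℕ ↦ vonMangoldt n * (n : ℝ) ^ (-σ) := by
  have h := (LSeriesSummable_vonMangoldt (s := (σ : ℂ)) (by simpa)).norm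
  refine h.congr fun n ↦ ?_
  rw [LSeries.norm_term_eq]
  split_ifs with hn
  · simp [hn]
  · simp [Real.rpow_neg, div_eq_mul_inv]

/-- Near the pole, `-ζ'/ζ` is bounded by a constant times `1 / |s - 1|`. -/
lemma exists_norm_LSeries_vonMangoldt_le (R : ℝ) :
    ∃ K > 0, ∀ σ : ℝ, 1 < σ → σ ≤ 2 → ∀ t : ℝ, |t| ≤ R →
      ‖LSeries (fun n ↦ (ArithmeticFunction.vonMangoldt n : ℂ)) (σ + t * I)‖ ≤
        K / ‖(σ : ℂ) + t * I - 1‖ := by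
  set H : ℂ → ℂ := fun s ↦ 1 - (s - 1) * (deriv riemannZeta₁ s / riemannZeta₁ s)
  have hne (s : ℂ) (hs : 1 ≤ s.re) : riemannZeta₁ s ≠ 0 := by
    rcases eq_or_ne s 1 with rfl | h1
    · simp
    · have := riemannZeta_ne_zero_of_one_le_re hs
      rw [riemannZeta_eq_inv_sub_mul h1] at this
      exact right_ne_zero_of_mul this
  have hH : ContinuousOn H {s | 1 ≤ s.re} := by
    have h1 := differentiable_riemannZeta₁.deriv.continuous
    have h2 := differentiable_riemannZeta₁.continuous
    exact continuousOn_const.sub ((continuousOn_id.sub continuousOn_const).mul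
      (h1.continuousOn.div h2.continuousOn hne))
  obtain ⟨K, hK⟩ := (isCompact_Icc.reProdIm isCompact_Icc).exists_bound_of_continuousOn
    (hH.mono (t := Set.Icc 1 2 ×ℂ Set.Icc (-R) R) fun s hs ↦ hs.1.1)
  refine ⟨max K 1, by positivity, fun σ h1 h2 t ht ↦ ?_⟩
  set s : ℂ := σ + t * I with hs
  have hre : s.re = σ := by simp [hs]
  have him : s.im = t := by simp [hs]
  have hs1 : s ≠ 1 := fun h ↦ by rw [h, one_re] at hre; linarith
  have hs1' : s - 1 ≠ 0 := sub_ne_zero.mpr hs1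
  have hK' := hK s ⟨by rw [Set.mem_preimage, hre]; exact ⟨h1.le, h2⟩,
    by rw [Set.mem_preimage, him]; exact abs_le.mp ht⟩
  rw [ArithmeticFunction.LSeries_vonMangoldt_eq_deriv_riemannZeta_div (by rw [hre]; exact h1),
    le_div_iff₀ (norm_pos_iff.mpr hs1'), ← norm_mul]
  refine le_trans (le_of_eq ?_) (hK'.trans (le_max_left _ _))
  congr 1
  have := hne s (by rw [hre]; exact h1.le)
  rw [deriv_riemannZeta_eq_neg_inv_sub_sq_mul_add hs1, riemannZeta_eq_inv_sub_mul hs1]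
  simp only [H]
  field_simp
  ring

/-- The mean square of `ζ'/ζ` on vertical segments of fixed length is `O(1 / (σ - 1))`. -/
lemma exists_integral_normSq_LSeries_vonMangoldt_le {δ : ℝ} (hδ : 0 < δ) :
    ∃ K > 0, ∀ σ : ℝ, 1 < σ → σ ≤ 2 → ∀ T : ℝ,
      ∫ t in T..(T + δ), ‖LSeries (fun n ↦ (ArithmeticFunction.vonMangoldt n : ℂ)) (σ + t * I)‖ ^ 2
        ≤ K / (σ - 1) := by
  obtain ⟨K, hK0, hK⟩ := exists_norm_LSeries_vonMangoldt_le (2 * δ)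
  refine ⟨2 * (K ^ 2 * π), by positivity, fun σ h1 h2 T ↦ ?_⟩
  have hpos : 0 < σ - 1 := by linarith
  have ha (n : ℕ) : 0 ≤ ArithmeticFunction.vonMangoldt n * (n : ℝ) ^ (-σ) :=
    mul_nonneg ArithmeticFunction.vonMangoldt_nonneg (by positivity)
  have hle := integral_normSq_expSum_interval_le ha (summable_vonMangoldt_mul_rpow h1)
    (fun n ↦ Real.log n) hδ T
  simp_rw [← LSeries_vonMangoldt_eq_expSum] at hle
  refine hle.trans ?_
  rw [mul_div_assoc]
  gcongr
  have hform (t : ℝ) : ‖(σ : ℂ) + t * I - 1‖ ^ 2 = (σ - 1) ^ 2 + t ^ 2 := by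
    rw [Complex.sq_norm, normSq_apply]; simp; ring
  have hcont : Continuous fun t : ℝ ↦ K ^ 2 / ((σ - 1) ^ 2 + t ^ 2) :=
    continuous_const.div (by fun_prop) fun t ↦ by positivity
  calc _ ≤ ∫ t in (-(2 * δ))..(2 * δ), K ^ 2 / ((σ - 1) ^ 2 + t ^ 2) := by
        refine intervalIntegral.integral_mono_on (by linarith) ?_ (hcont.intervalIntegrable _ _)
          fun t ht ↦ ?_
        · simp_rw [LSeries_vonMangoldt_eq_expSum]
          exact ((continuous_expSum ha (summable_vonMangoldt_mul_rpow h1) _).norm.pow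
            2).intervalIntegrable _ _
        · rw [← hform, ← div_pow]
          gcongr
          exact hK σ h1 h2 t (abs_le.mpr ht)
    _ = K ^ 2 / (σ - 1) * ∫ t in (-(2 * δ) / (σ - 1))..(2 * δ / (σ - 1)), (1 + t ^ 2)⁻¹ := by
        rw [← intervalIntegral.inv_smul_integral_comp_div, smul_eq_mul,
          ← mul_assoc, ← intervalIntegral.integral_const_mul]
        refine intervalIntegral.integral_congr fun t _ ↦ ?_
        field_simp
    _ ≤ K ^ 2 / (σ - 1) * π := by
        gcongr
        rw [integral_inv_one_add_sq]
        linarith [Real.arctan_lt_pi_div_two (2 * δ / (σ - 1)),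
          Real.neg_pi_div_two_lt_arctan (-(2 * δ) / (σ - 1))]
    _ = _ := by ring

lemma exists_norm_riemannZeta_ofReal_le :
    ∃ K ≥ 1, ∀ σ : ℝ, 1 < σ → σ ≤ 2 → ‖riemannZeta σ‖ ≤ K / (σ - 1) := by
  obtain ⟨K, hK⟩ := (isCompact_Icc (a := (1 : ℝ)) (b := 2)).exists_bound_of_continuousOn
    (f := fun σ : ℝ ↦ riemannZeta₁ σ)
    (differentiable_riemannZeta₁.continuous.comp continuous_ofReal).continuousOn
  refine ⟨max K 1, le_max_right _ _, fun σ h1 h2 ↦ ?_⟩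
  have hpos : 0 < σ - 1 := by linarith
  have hne : (σ : ℂ) ≠ 1 := by exact_mod_cast h1.ne'
  rw [riemannZeta_eq_inv_sub_mul hne, norm_mul, norm_inv, ← ofReal_one, ← ofReal_sub,
    Complex.norm_of_nonneg hpos.le, inv_mul_eq_div]
  gcongr
  exact (hK σ ⟨h1.le, h2⟩).trans (le_max_left _ _)

/-- `log ζ` on the half-plane of absolute convergence. -/
noncomputable def logZeta (s : ℂ) : ℂ :=
  LSeries (fun n : ℕ ↦ (ArithmeticFunction.vonMangoldt n : ℂ) / (Real.log n : ℂ)) s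

lemma abscissaOfAbsConv_vonMangoldt_div_log_le : LSeries.abscissaOfAbsConv
    (fun n : ℕ ↦ (ArithmeticFunction.vonMangoldt n : ℂ) / (Real.log n : ℂ)) ≤ 1 := by
  refine LSeries.abscissaOfAbsConv_le_of_le_const ⟨1, fun n hn ↦ ?_⟩
  have hlog : 0 ≤ Real.log n := Real.log_natCast_nonneg n
  rw [norm_div, Complex.norm_of_nonneg ArithmeticFunction.vonMangoldt_nonneg,
    Complex.norm_of_nonneg hlog]
  exact div_le_one_of_le₀ ArithmeticFunction.vonMangoldt_le_log hlog

lemma hasDerivAt_logZeta {s : ℂ} (hs : 1 < s.re) :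
    HasDerivAt logZeta (-LSeries (fun n ↦ (ArithmeticFunction.vonMangoldt n : ℂ)) s) s := by
  have h := LSeries_hasDerivAt
    (abscissaOfAbsConv_vonMangoldt_div_log_le.trans_lt (by exact_mod_cast hs))
  refine h.congr_deriv (congrArg Neg.neg (LSeries_congr (fun {n} hn ↦ ?_) s)).symm
  rw [LSeries.logMul]
  rcases eq_or_ne n 1 with rfl | h1
  · simp
  · have : (Real.log n : ℂ) ≠ 0 := by
      rw [Ne, ofReal_eq_zero]
      exact (Real.log_pos (by exact_mod_cast (by omega : 1 < n))).ne'
    rw [← natCast_log]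
    field_simp

lemma abs_re_logZeta_le {σ : ℝ} (hσ : 1 < σ) (t : ℝ) :
    Real.exp |(logZeta (σ + t * I)).re| ≤ ‖riemannZeta σ‖ := by
  rw [← riemannZeta_eq_exp_LSeries (by simpa), norm_exp]
  gcongr
  refine (abs_re_le_norm _).trans ?_
  set f : ℕ → ℂ := fun n : ℕ ↦ (ArithmeticFunction.vonMangoldt n : ℂ) / (Real.log n : ℂ)
  have hterm (n : ℕ) : LSeries.term f σ n = (‖LSeries.term f (σ + t * I) n‖ : ℂ) := by
    rw [LSeries.norm_term_eq, LSeries.term]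
    split_ifs with hn
    · simp
    · have hlog : 0 ≤ Real.log n := Real.log_natCast_nonneg n
      simp only [f, norm_div, Complex.norm_of_nonneg ArithmeticFunction.vonMangoldt_nonneg,
        Complex.norm_of_nonneg hlog]
      simp [ofReal_cpow]
  have hsum : Summable fun n ↦ ‖LSeries.term f (σ + t * I) n‖ :=
    (LSeriesSummable_of_abscissaOfAbsConv_lt_re
      (abscissaOfAbsConv_vonMangoldt_div_log_le.trans_lt
      (by simpa using (by exact_mod_cast hσ : (1 : EReal) < σ)))).norm
  refine (norm_tsum_le_tsum_norm hsum).trans_eq ?_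
  rw [LSeries, tsum_congr hterm, ← ofReal_tsum, ofReal_re]

lemma sq_integral_mul_le {a b : ℝ} (hab : a ≤ b) {f g : ℝ → ℝ} (hf : Continuous f)
    (hg : Continuous g) :
    (∫ x in a..b, f x * g x) ^ 2 ≤ (∫ x in a..b, f x ^ 2) * ∫ x in a..b, g x ^ 2 := by
  have key (r : ℝ) : 0 ≤ (∫ x in a..b, f x ^ 2) * (r * r) + (2 * ∫ x in a..b, f x * g x) * r +
      ∫ x in a..b, g x ^ 2 := by
    have h : ∫ x in a..b, (r * f x + g x) ^ 2 = (∫ x in a..b, f x ^ 2) * (r * r) +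
        (2 * ∫ x in a..b, f x * g x) * r + ∫ x in a..b, g x ^ 2 := by
      have (x : ℝ) : (r * f x + g x) ^ 2 = r * r * f x ^ 2 + 2 * r * (f x * g x) + g x ^ 2 := by
        ring
      simp_rw [this]
      rw [intervalIntegral.integral_add (Continuous.intervalIntegrable (by fun_prop) _ _)
        (Continuous.intervalIntegrable (by fun_prop) _ _),
        intervalIntegral.integral_add (Continuous.intervalIntegrable (by fun_prop) _ _)
        (Continuous.intervalIntegrable (by fun_prop) _ _), intervalIntegral.integral_const_mul,
        intervalIntegral.integral_const_mul]
      ring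
    rw [← h]
    exact intervalIntegral.integral_nonneg hab fun _ _ ↦ sq_nonneg _
  have := discrim_le_zero key
  rw [discrim] at this
  nlinarith

lemma integral_exp_mul_le {c : ℝ} (hc : 0 < c) (x₀ : ℝ) :
    ∫ x in x₀..0, Real.exp (c * x) ≤ 1 / c := by
  rw [intervalIntegral.integral_comp_mul_left (fun x ↦ Real.exp x) hc.ne', integral_exp]
  simp only [mul_zero, Real.exp_zero, smul_eq_mul, one_div]
  have := Real.exp_pos (c * x₀)
  exact mul_le_of_le_one_right (by positivity) (by linarith)

lemma exists_integral_norm_riemannZeta_rpow_le {δ : ℝ} (hδ : 0 < δ) {p : ℝ} (hp : |p| < 1) :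
    ∃ C, ∀ T x₀ : ℝ, x₀ ≤ 0 →
      ∫ t in T..(T + δ), ‖riemannZeta ((1 + Real.exp x₀ : ℝ) + t * I)‖ ^ p ≤ C := by
  obtain ⟨K, hK1, hK⟩ := exists_norm_riemannZeta_ofReal_le
  obtain ⟨M, hM0, hM⟩ := exists_integral_normSq_LSeries_vonMangoldt_le hδ
  set q : ℝ := p / 2 with hq
  have hq2 : |q| = |p| / 2 := by rw [hq, abs_div, abs_two]
  set β : ℝ := (1 - |p|) / 4 with hβ
  have hβ0 : 0 < β := by rw [hβ]; linarith
  set s : ℝ → ℝ → ℂ := fun x t ↦ (1 + Real.exp x : ℝ) + t * I with hs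
  have hsre (x t : ℝ) : 1 < (s x t).re := by
    simp only [hs, add_re, ofReal_re, re_ofReal_mul, I_re, mul_zero]
    linarith [Real.exp_pos x]
  have hsc : Continuous fun z : ℝ × ℝ ↦ s z.1 z.2 := by simp only [hs]; fun_prop
  set Λ : ℂ → ℂ := LSeries (fun n ↦ (ArithmeticFunction.vonMangoldt n : ℂ)) with hΛ
  have hΛd : DifferentiableOn ℂ Λ {s | 1 < s.re} := by
    refine (LSeries_differentiableOn _).mono fun s hs ↦ ?_
    refine lt_of_le_of_lt (LSeries.abscissaOfAbsConv_le_of_forall_lt_LSeriesSummable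
      (x := 1) fun y hy ↦ ?_) (b := ((1 : ℝ) : EReal)) (EReal.coe_lt_coe_iff.mpr hs)
    exact ArithmeticFunction.LSeriesSummable_vonMangoldt (by simpa)
  have hΛc : Continuous fun z : ℝ × ℝ ↦ Λ (s z.1 z.2) :=
    hΛd.continuousOn.comp_continuous hsc fun z ↦ hsre _ _
  have hLc : Continuous fun z : ℝ × ℝ ↦ logZeta (s z.1 z.2) :=
    ContinuousOn.comp_continuous (s := {s | 1 < s.re})
      (fun w hw ↦ (hasDerivAt_logZeta hw).continuousAt.continuousWithinAt) hsc fun z ↦ hsre _ _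
  set E : ℝ → ℝ → ℂ := fun x t ↦ cexp (q * logZeta (s x t)) with hE
  have hEc : Continuous fun z : ℝ × ℝ ↦ E z.1 z.2 := by simp only [hE]; fun_prop
  have hEsq (x t : ℝ) : ‖riemannZeta (s x t)‖ ^ p = ‖E x t‖ ^ 2 := by
    rw [← riemannZeta_eq_exp_LSeries (hsre x t), norm_exp, norm_exp, ← Real.exp_mul,
      ← Real.exp_nat_mul]
    congr 1
    rw [re_ofReal_mul, hq]
    simp only [logZeta]
    push_cast
    ring
  have hEle (x t : ℝ) (hx : x ≤ 0) : ‖E x t‖ ≤ K ^ |q| * Real.exp (-(|q| * x)) := by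
    have h1 : ‖E x t‖ ≤ (Real.exp |(logZeta (s x t)).re|) ^ |q| := by
      rw [hE, norm_exp, ← Real.exp_mul, re_ofReal_mul]
      refine Real.exp_le_exp.mpr ((le_abs_self _).trans_eq ?_)
      rw [abs_mul, mul_comm]
    have h2 := (abs_re_logZeta_le (σ := 1 + Real.exp x) (by simp [Real.exp_pos]) t).trans
      (hK _ (by simp [Real.exp_pos]) (by linarith [Real.exp_le_one_iff.mpr hx]))
    refine h1.trans ((Real.rpow_le_rpow (by positivity) h2 (abs_nonneg q)).trans_eq ?_)
    rw [add_sub_cancel_left, Real.div_rpow (by positivity) (by positivity), ← Real.exp_mul,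
      Real.exp_neg, mul_comm x, div_eq_mul_inv]
  have hderiv (x t : ℝ) :
      HasDerivAt (fun x ↦ E x t) (E x t * (q * (-Λ (s x t) * Real.exp x))) x := by
    have h1 : HasDerivAt (fun x : ℝ ↦ s x t) (Real.exp x) x := by
      simp only [hs]
      exact (((Real.hasDerivAt_exp x).const_add 1).ofReal_comp).add_const _
    exact (((hasDerivAt_logZeta (hsre x t)).comp x h1).const_mul (q : ℂ)).cexp
  set N : ℝ → ℝ → ℝ := fun x t ↦ ‖Λ (s x t)‖ with hN
  have hNc : Continuous fun z : ℝ × ℝ ↦ N z.1 z.2 := hΛc.norm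
  have hN2 (x T : ℝ) (hx : x ≤ 0) : ∫ t in T..(T + δ), N x t ^ 2 ≤ M * Real.exp (-x) := by
    have := hM (1 + Real.exp x) (by simp [Real.exp_pos])
      (by linarith [Real.exp_le_one_iff.mpr hx]) T
    rwa [add_sub_cancel_left, div_eq_mul_inv, ← Real.exp_neg] at this
  have hKq : 0 < K ^ |q| := by positivity
  have hNeq (x t : ℝ) : ‖Λ (s x t)‖ = N x t := rfl
  have hN0 (x t : ℝ) : 0 ≤ N x t := norm_nonneg _
  clear_value E N Λ
  -- the pointwise bound obtained by integrating in the horizontal direction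
  have hpt (x₀ t : ℝ) (hx₀ : x₀ ≤ 0) : ‖E x₀ t‖ ^ 2 ≤ 2 * (K ^ |q|) ^ 2 *
      (1 + 1 / (2 * β) * ∫ x in x₀..0, Real.exp ((1 + 2 * β) * x) * N x t ^ 2) := by
    have hxt : Continuous fun x : ℝ ↦ (x, t) := by fun_prop
    have hNt : Continuous fun x ↦ N x t := hNc.comp hxt
    have hΛt : Continuous fun x ↦ Λ (s x t) := hΛc.comp hxt
    have hEt : Continuous fun x ↦ E x t := hEc.comp hxt
    have hprod : Continuous fun x ↦ E x t * (q * (-Λ (s x t) * Real.exp x)) :=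
      hEt.mul (continuous_const.mul (hΛt.neg.mul (by fun_prop)))
    set J : ℝ := ∫ x in x₀..0, Real.exp (β * x) * (Real.exp ((1 / 2 + β) * x) * N x t) with hJ
    have hJ0 : 0 ≤ J := intervalIntegral.integral_nonneg hx₀ fun x _ ↦ by
      have := hN0 x t
      positivity
    have hftc := intervalIntegral.integral_eq_sub_of_hasDerivAt (a := x₀) (b := 0)
      (fun x _ ↦ hderiv x t) (hprod.intervalIntegrable _ _)
    have hint : ‖∫ x in x₀..0, E x t * (q * (-Λ (s x t) * Real.exp x))‖ ≤ K ^ |q| * J := by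
      rw [hJ, ← intervalIntegral.integral_const_mul]
      refine intervalIntegral.norm_integral_le_of_norm_le hx₀ (.of_forall fun x hx ↦ ?_)
        (Continuous.intervalIntegrable (by fun_prop) _ _)
      have hq1 : |q| ≤ 1 := by linarith
      have hre : ‖E x t * (q * (-Λ (s x t) * Real.exp x))‖ =
          ‖E x t‖ * (|q| * (N x t * Real.exp x)) := by
        rw [norm_mul, norm_mul, norm_mul, norm_neg, norm_real, Real.norm_eq_abs, hNeq,
          Complex.norm_of_nonneg (Real.exp_pos x).le]
      rw [hre]
      have := hN0 x t
      calc _ ≤ K ^ |q| * Real.exp (-(|q| * x)) * (1 * (N x t * Real.exp x)) := by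
            gcongr
            exact hEle x t hx.2
        _ = K ^ |q| * (Real.exp (-(|q| * x)) * Real.exp x * N x t) := by ring
        _ = K ^ |q| * (Real.exp (β * x) * Real.exp ((1 / 2 + β) * x) * N x t) := by
            have : -(|q| * x) + x = β * x + (1 / 2 + β) * x := by rw [hq2, hβ]; ring
            rw [← Real.exp_add, ← Real.exp_add, this]
        _ = _ := by ring
    have hE0 : ‖E 0 t‖ ≤ K ^ |q| := by simpa using hEle 0 t le_rfl
    have hle : ‖E x₀ t‖ ≤ K ^ |q| * (1 + J) := by
      have : E x₀ t = E 0 t - ∫ x in x₀..0, E x t * (q * (-Λ (s x t) * Real.exp x)) := by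
        rw [hftc]; ring
      rw [this]
      linarith [norm_sub_le (E 0 t) (∫ x in x₀..0, E x t * (q * (-Λ (s x t) * Real.exp x)))]
    have hJ2 : J ^ 2 ≤ 1 / (2 * β) * ∫ x in x₀..0, Real.exp ((1 + 2 * β) * x) * N x t ^ 2 := by
      have h := sq_integral_mul_le hx₀ (f := fun x ↦ Real.exp (β * x))
        (g := fun x ↦ Real.exp ((1 / 2 + β) * x) * N x t) (by fun_prop) (by fun_prop)
      refine h.trans ?_
      have e1 (x : ℝ) : Real.exp (β * x) ^ 2 = Real.exp (2 * β * x) := by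
        rw [← Real.exp_nat_mul]; push_cast; ring_nf
      have e2 (x : ℝ) : (Real.exp ((1 / 2 + β) * x) * N x t) ^ 2 =
          Real.exp ((1 + 2 * β) * x) * N x t ^ 2 := by
        rw [mul_pow, ← Real.exp_nat_mul]; push_cast; ring_nf
      simp_rw [e1, e2]
      gcongr
      · exact intervalIntegral.integral_nonneg hx₀ fun x _ ↦ by positivity
      · exact integral_exp_mul_le (by positivity) x₀
    calc ‖E x₀ t‖ ^ 2 ≤ (K ^ |q| * (1 + J)) ^ 2 := by gcongr
      _ ≤ 2 * (K ^ |q|) ^ 2 * (1 + J ^ 2) := by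
          nlinarith [mul_nonneg (sq_nonneg (K ^ |q|)) (sq_nonneg (1 - J))]
      _ ≤ _ := by gcongr
  refine ⟨2 * (K ^ |q|) ^ 2 * (δ + 1 / (2 * β) * (M * (1 / (2 * β)))), fun T x₀ hx₀ ↦ ?_⟩
  change ∫ t in T..(T + δ), ‖riemannZeta (s x₀ t)‖ ^ p ≤ _
  simp_rw [hEsq]
  have hIc : Continuous fun t ↦ ∫ x in x₀..0, Real.exp ((1 + 2 * β) * x) * N x t ^ 2 :=
    continuous_parametric_intervalIntegral_of_continuous'
      (f := fun t x ↦ Real.exp ((1 + 2 * β) * x) * N x t ^ 2) (by fun_prop) _ _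
  have hTδ : T ≤ T + δ := by linarith
  calc _ ≤ ∫ t in T..(T + δ), 2 * (K ^ |q|) ^ 2 *
      (1 + 1 / (2 * β) * ∫ x in x₀..0, Real.exp ((1 + 2 * β) * x) * N x t ^ 2) :=
        intervalIntegral.integral_mono_on hTδ (Continuous.intervalIntegrable (by fun_prop) _ _)
          (Continuous.intervalIntegrable (by fun_prop) _ _) fun t _ ↦ hpt x₀ t hx₀
    _ = 2 * (K ^ |q|) ^ 2 * (δ + 1 / (2 * β) *
        ∫ t in T..(T + δ), ∫ x in x₀..0, Real.exp ((1 + 2 * β) * x) * N x t ^ 2) := by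
        rw [intervalIntegral.integral_const_mul, intervalIntegral.integral_add (by simp)
          (Continuous.intervalIntegrable (by fun_prop) _ _), intervalIntegral.integral_const_mul]
        simp
    _ ≤ _ := by
        gcongr
        rw [intervalIntegral_intervalIntegral_swap]
        · calc _ ≤ ∫ x in x₀..0, M * Real.exp (2 * β * x) := by
                refine intervalIntegral.integral_mono_on hx₀ ?_
                  (Continuous.intervalIntegrable (by fun_prop) _ _) fun x hx ↦ ?_
                · exact (continuous_parametric_intervalIntegral_of_continuous'
                    (f := fun x t ↦ Real.exp ((1 + 2 * β) * x) * N x t ^ 2)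
                    (by fun_prop) _ _).intervalIntegrable _ _
                · rw [intervalIntegral.integral_const_mul]
                  calc _ ≤ Real.exp ((1 + 2 * β) * x) * (M * Real.exp (-x)) := by
                        gcongr
                        exact hN2 x T hx.2
                    _ = M * (Real.exp ((1 + 2 * β) * x) * Real.exp (-x)) := by ring
                    _ = _ := by rw [← Real.exp_add]; ring_nf
            _ ≤ _ := by
                rw [intervalIntegral.integral_const_mul]
                gcongr
                exact integral_exp_mul_le (by positivity) x₀
        · refine (ContinuousOn.integrableOn_compact (isCompact_uIcc.prod isCompact_uIcc)
            (Continuous.continuousOn ?_)).mono_set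
            (Set.prod_mono Set.uIoc_subset_uIcc Set.uIoc_subset_uIcc)
          fun_prop

/-- Vertical integrals depend continuously on the abscissa, up to the line `Re s = 1`. -/
lemma tendsto_integral_vertical {g : ℂ → ℝ} (hg : ContinuousOn g {s | 1 ≤ s.re ∧ 1 ≤ s.im})
    {T δ : ℝ} (hT : 1 ≤ T) (hδ : 0 < δ) :
    Tendsto (fun x ↦ ∫ t in T..(T + δ), g ((1 + Real.exp x : ℝ) + t * I)) atBot
      (nhds (∫ t in T..(T + δ), g (1 + t * I))) := by
  set F : ℝ → ℝ := fun ε ↦ ∫ t in T..(T + δ), g ((1 + |ε| : ℝ) + (max t 1 : ℝ) * I)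
  have hF : Continuous F := by
    refine continuous_parametric_intervalIntegral_of_continuous'
      (f := fun (ε t : ℝ) ↦ g ((1 + |ε| : ℝ) + (max t 1 : ℝ) * I)) ?_ _ _
    refine hg.comp_continuous (f := fun z : ℝ × ℝ ↦ ((1 + |z.1| : ℝ) + (max z.2 1 : ℝ) * I : ℂ))
      (by fun_prop) fun z ↦ ?_
    simp
  have h := (hF.tendsto 0).comp Real.tendsto_exp_atBot
  have hmax (t : ℝ) (ht : t ∈ Set.uIcc T (T + δ)) : max t 1 = t := by
    rw [Set.uIcc_of_le (by linarith)] at ht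
    exact max_eq_left (hT.trans ht.1)
  convert h using 1
  · funext x
    refine intervalIntegral.integral_congr fun t ht ↦ ?_
    simp only [hmax t ht, abs_of_pos (Real.exp_pos x)]
  · congr 1
    refine intervalIntegral.integral_congr fun t ht ↦ ?_
    simp [hmax t ht]

lemma continuousOn_riemannZeta_of_one_le :
    ContinuousOn riemannZeta {s | 1 ≤ s.re ∧ 1 ≤ s.im} := by
  refine differentiableOn_riemannZeta.continuousOn.mono fun s hs h ↦ ?_
  have := hs.2
  rw [Set.mem_singleton_iff.mp h, one_im] at this
  linarith

lemma continuousOn_norm_riemannZeta_rpow (p : ℝ) :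
    ContinuousOn (fun s ↦ ‖riemannZeta s‖ ^ p) {s | 1 ≤ s.re ∧ 1 ≤ s.im} := by
  refine continuousOn_riemannZeta_of_one_le.norm.rpow_const fun s hs ↦
    .inl (norm_ne_zero_iff.mpr (riemannZeta_ne_zero_of_one_le_re hs.1))

lemma exists_integral_norm_riemannZeta_one_rpow_le {δ : ℝ} (hδ : 0 < δ) {p : ℝ} (hp : |p| < 1) :
    ∃ C, ∀ T : ℝ, 1 ≤ T → ∫ t in T..(T + δ), ‖riemannZeta (1 + t * I)‖ ^ p ≤ C := by
  obtain ⟨C, hC⟩ := exists_integral_norm_riemannZeta_rpow_le hδ hp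
  refine ⟨C, fun T hT ↦ le_of_tendsto
    (tendsto_integral_vertical (continuousOn_norm_riemannZeta_rpow p) hT hδ) ?_⟩
  filter_upwards [eventually_le_atBot 0] with x hx using hC T x hx

lemma tendsto_mean_cexp (x T₀ : ℝ) :
    Tendsto (fun X : ℝ ↦ (X : ℂ)⁻¹ * ∫ t in T₀..(T₀ + X), cexp (x * t * I)) atTop
      (nhds (if x = 0 then 1 else 0)) := by
  split_ifs with hx
  · refine tendsto_const_nhds.congr' ?_
    filter_upwards [eventually_gt_atTop 0] with X hX
    have : (X : ℂ) ≠ 0 := by exact_mod_cast hX.ne'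
    simp [hx, this]
  · have hxc : (x : ℂ) * I ≠ 0 := by simp [hx]
    rw [tendsto_zero_iff_norm_tendsto_zero]
    refine squeeze_zero' (.of_forall fun _ ↦ norm_nonneg _) ?_
      (tendsto_inv_atTop_zero.mul_const (2 / |x|) |>.congr' .rfl |>.trans_eq (by simp))
    filter_upwards [eventually_gt_atTop 0] with X hX
    have h : ∫ t in T₀..(T₀ + X), cexp (x * t * I) =
        (cexp (x * I * (T₀ + X : ℝ)) - cexp (x * I * T₀)) / (x * I) := by
      rw [← integral_exp_mul_complex hxc]
      exact intervalIntegral.integral_congr fun t _ ↦ by ring_nf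
    have hn (y : ℝ) : ‖cexp (x * I * y)‖ = 1 := by
      rw [mul_right_comm, ← ofReal_mul, norm_exp_ofReal_mul_I]
    rw [h, norm_mul, norm_inv, Complex.norm_of_nonneg hX.le, norm_div, norm_mul, norm_I, mul_one,
      norm_real, Real.norm_eq_abs]
    gcongr
    refine (norm_sub_le _ _).trans_eq ?_
    rw [hn, hn]
    norm_num

lemma tendsto_mean_sum_cexp {ι : Type*} (s : Finset ι) (c : ι → ℂ) (x : ι → ℝ) (T₀ : ℝ) :
    Tendsto (fun X : ℝ ↦ (X : ℂ)⁻¹ * ∫ t in T₀..(T₀ + X), ∑ i ∈ s, c i * cexp (x i * t * I)) atTop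
      (nhds (∑ i ∈ s, if x i = 0 then c i else 0)) := by
  have h : Tendsto (fun X : ℝ ↦ ∑ i ∈ s, c i *
      ((X : ℂ)⁻¹ * ∫ t in T₀..(T₀ + X), cexp (x i * t * I))) atTop
      (nhds (∑ i ∈ s, c i * if x i = 0 then 1 else 0)) :=
    tendsto_finsetSum _ fun i _ ↦ (tendsto_mean_cexp (x i) T₀).const_mul (c i)
  simp only [mul_ite, mul_one, mul_zero] at h
  refine h.congr fun X ↦ ?_
  rw [intervalIntegral.integral_finsetSum fun i _ ↦
    Continuous.intervalIntegrable (by fun_prop) _ _, Finset.mul_sum]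
  refine Finset.sum_congr rfl fun i _ ↦ ?_
  rw [intervalIntegral.integral_const_mul]
  ring

lemma norm_sum_mul_card_le_mul_card {χ : ℕ → ℤ} (hmul : ∀ m n, χ (m * n) = χ m * χ n)
    (hsq : ∀ n ≠ 0, χ n ^ 2 = 1) {F S : Finset ℕ} (hF : 0 ∉ F) (hS : 0 ∉ S) (b : ℕ → ℂ)
    {B T₀ : ℝ} (hb : ∀ t ≥ T₀, ‖∑ n ∈ F, b n * cexp (-Real.log n * t * I)‖ ≤ B) :
    ‖∑ n ∈ F, b n * χ n * ({m ∈ S | n * m ∈ S} : Finset ℕ).card‖ ≤ B * S.card := by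
  set D : ℝ → ℂ := fun t ↦ ∑ m ∈ S, χ m * cexp (Real.log m * t * I) with hD
  have hconj (t : ℝ) : (starRingEnd ℂ) (D t) = ∑ m ∈ S, χ m * cexp (-Real.log m * t * I) := by
    simp only [hD, map_sum, map_mul, ← exp_conj, conj_ofReal, conj_I, map_intCast]
    exact Finset.sum_congr rfl fun m _ ↦ by ring_nf
  have hDsq (t : ℝ) : ((‖D t‖ ^ 2 : ℝ) : ℂ) = ∑ z ∈ S ×ˢ S, (χ z.1 * χ z.2 : ℂ) *
      cexp ((Real.log z.1 - Real.log z.2 : ℝ) * t * I) := by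
    rw [← normSq_eq_norm_sq, ← mul_conj, hconj, hD, Finset.sum_mul_sum, Finset.sum_product]
    refine Finset.sum_congr rfl fun m _ ↦ Finset.sum_congr rfl fun m' _ ↦ ?_
    rw [mul_mul_mul_comm, ← Complex.exp_add]
    push_cast
    ring_nf
  have hAD (t : ℝ) : (∑ n ∈ F, b n * cexp (-Real.log n * t * I)) * (‖D t‖ ^ 2 : ℝ) =
      ∑ z ∈ F ×ˢ (S ×ˢ S), (b z.1 * (χ z.2.1 * χ z.2.2 : ℂ)) *
        cexp ((Real.log z.2.1 - Real.log z.2.2 - Real.log z.1 : ℝ) * t * I) := by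
    rw [hDsq, Finset.sum_mul_sum, Finset.sum_product F]
    refine Finset.sum_congr rfl fun m _ ↦ Finset.sum_congr rfl fun m' _ ↦ ?_
    rw [mul_mul_mul_comm, ← Complex.exp_add]
    push_cast
    ring_nf
  have hχ (n : ℕ) (hn : n ≠ 0) : (χ n : ℂ) * χ n = 1 := by
    rw [← sq]; exact_mod_cast hsq n hn
  have hlog {m n : ℕ} (hm : m ≠ 0) (hn : n ≠ 0) : Real.log m - Real.log n = 0 ↔ m = n := by
    rw [sub_eq_zero]
    refine ⟨fun h ↦ ?_, fun h ↦ by rw [h]⟩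
    exact_mod_cast Real.log_injOn_pos (by simpa using hm.pos) (by simpa using hn.pos) h
  have lim1 : Tendsto (fun X : ℝ ↦ (X : ℂ)⁻¹ * ∫ t in T₀..(T₀ + X), ((‖D t‖ ^ 2 : ℝ) : ℂ)) atTop
      (nhds S.card) := by
    simp_rw [hDsq]
    convert tendsto_mean_sum_cexp (S ×ˢ S) (fun z ↦ (χ z.1 * χ z.2 : ℂ))
      (fun z ↦ Real.log z.1 - Real.log z.2) T₀ using 2
    rw [Finset.sum_product, Finset.card_eq_sum_ones, Nat.cast_sum]
    refine Finset.sum_congr rfl fun m hm ↦ ?_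
    have hm0 := ne_of_mem_of_not_mem hm hS
    rw [Finset.sum_eq_single_of_mem m hm]
    · simp [hχ m hm0]
    · intro m' hm' hne
      rw [if_neg]
      rw [hlog hm0 (ne_of_mem_of_not_mem hm' hS)]
      exact hne.symm
  have lim2 : Tendsto (fun X : ℝ ↦ (X : ℂ)⁻¹ * ∫ t in T₀..(T₀ + X),
      (∑ n ∈ F, b n * cexp (-Real.log n * t * I)) * (‖D t‖ ^ 2 : ℝ)) atTop
      (nhds (∑ n ∈ F, b n * χ n * ({m ∈ S | n * m ∈ S} : Finset ℕ).card)) := by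
    simp_rw [hAD]
    convert tendsto_mean_sum_cexp (F ×ˢ (S ×ˢ S)) (fun z ↦ b z.1 * (χ z.2.1 * χ z.2.2 : ℂ))
      (fun z ↦ Real.log z.2.1 - Real.log z.2.2 - Real.log z.1) T₀ using 2
    rw [Finset.sum_product]
    refine Finset.sum_congr rfl fun n hn ↦ ?_
    have hn0 := ne_of_mem_of_not_mem hn hF
    rw [Finset.sum_product_right, Finset.card_filter, Nat.cast_sum, Finset.mul_sum]
    refine Finset.sum_congr rfl fun m hm ↦ ?_
    have hm0 := ne_of_mem_of_not_mem hm hS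
    have hiff (m' : ℕ) (hm' : m' ∈ S) :
        Real.log m' - Real.log m - Real.log n = 0 ↔ n * m = m' := by
      rw [sub_sub, ← Real.log_mul (by exact_mod_cast hm0) (by exact_mod_cast hn0), ← Nat.cast_mul,
        hlog (ne_of_mem_of_not_mem hm' hS) (mul_ne_zero hm0 hn0), mul_comm, eq_comm]
    rw [Finset.sum_congr rfl fun m' hm' ↦ if_congr (hiff m' hm') rfl rfl, Finset.sum_ite_eq]
    split_ifs
    · rw [hmul]
      push_cast
      rw [mul_assoc (χ n : ℂ), hχ m hm0]
      ring
    · simp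
  refine le_of_tendsto_of_tendsto lim2.norm (lim1.norm.const_mul B |>.trans_eq (by simp)) ?_
  filter_upwards [eventually_gt_atTop 0] with X hX
  have hB : 0 ≤ B := (norm_nonneg _).trans (hb T₀ le_rfl)
  have hDc : Continuous D := by fun_prop
  rw [norm_mul, norm_mul, mul_left_comm]
  gcongr
  rw [intervalIntegral.integral_ofReal, norm_real, Real.norm_of_nonneg
    (intervalIntegral.integral_nonneg (by linarith) fun _ _ ↦ sq_nonneg _),
    ← intervalIntegral.integral_const_mul]
  refine intervalIntegral.norm_integral_le_of_norm_le (by linarith) (.of_forall fun t ht ↦ ?_)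
    (Continuous.intervalIntegrable (by fun_prop) _ _)
  rw [norm_mul, Complex.norm_of_nonneg (sq_nonneg _)]
  gcongr
  exact hb t ht.1.le

lemma tendsto_card_divisors_pow_succ_div {Q : ℕ} (hQ : Q ≠ 0) :
    Tendsto (fun k : ℕ ↦ ((Q ^ (k + 1)).divisors.card : ℝ) / (Q ^ k).divisors.card) atTop
      (nhds 1) := by
  have hcard (k : ℕ) : ((Q ^ k).divisors.card : ℝ) =
      ∏ p ∈ Q.primeFactors, ((k : ℝ) * Q.factorization p + 1) := by
    rcases eq_or_ne k 0 with rfl | hk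
    · simp
    · rw [Nat.card_divisors (pow_ne_zero _ hQ), Nat.primeFactors_pow _ hk]
      simp
  have h : Tendsto (fun k : ℕ ↦ ∏ p ∈ Q.primeFactors,
      (1 + (Q.factorization p : ℝ) / ((k : ℝ) * Q.factorization p + 1))) atTop
      (nhds (∏ p ∈ Q.primeFactors, (1 + 0))) := by
    refine tendsto_finsetProd _ fun p hp ↦ tendsto_const_nhds.add (tendsto_const_nhds.div_atTop ?_)
    refine tendsto_atTop_add_const_right _ _
      (tendsto_natCast_atTop_atTop.atTop_mul_const ?_)
    have := (Nat.prime_of_mem_primeFactors hp).factorization_pos_of_dvd hQ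
      (Nat.dvd_of_mem_primeFactors hp)
    exact_mod_cast this
  simp only [add_zero, Finset.prod_const_one] at h
  refine h.congr fun k ↦ ?_
  rw [hcard, hcard, ← Finset.prod_div_distrib]
  refine Finset.prod_congr rfl fun p _ ↦ ?_
  have : (k : ℝ) * Q.factorization p + 1 ≠ 0 := by positivity
  field_simp
  push_cast
  ring

lemma norm_sum_mul_le_of_forall_ge {χ : ℕ → ℤ} (hmul : ∀ m n, χ (m * n) = χ m * χ n)
    (hsq : ∀ n ≠ 0, χ n ^ 2 = 1) {F : Finset ℕ} (hF : 0 ∉ F) (b : ℕ → ℂ)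
    {B T₀ : ℝ} (hb : ∀ t ≥ T₀, ‖∑ n ∈ F, b n * cexp (-Real.log n * t * I)‖ ≤ B) :
    ‖∑ n ∈ F, b n * χ n‖ ≤ B := by
  set Q := ∏ n ∈ F, n with hQ
  have hQ0 : Q ≠ 0 := Finset.prod_ne_zero_iff.mpr fun n hn ↦ ne_of_mem_of_not_mem hn hF
  set S : ℕ → Finset ℕ := fun k ↦ (Q ^ k).divisors
  have hSpos (k : ℕ) : (0 : ℝ) < (S k).card := by
    exact_mod_cast Finset.card_pos.mpr (Nat.nonempty_divisors.mpr (pow_ne_zero _ hQ0))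
  have hlim (n : ℕ) (hn : n ∈ F) : Tendsto (fun k ↦
      (({m ∈ S k | n * m ∈ S k} : Finset ℕ).card : ℝ) / (S k).card) atTop (nhds 1) := by
    have h := (tendsto_card_divisors_pow_succ_div hQ0).const_sub 2
    norm_num at h
    refine tendsto_of_tendsto_of_tendsto_of_le_of_le h tendsto_const_nhds (fun k ↦ ?_) fun k ↦
      div_le_one_of_le₀ (Nat.cast_le.mpr (Finset.card_filter_le _ _)) (by positivity)
    have hsub : S k ⊆ S (k + 1) :=
      Nat.divisors_subset_of_dvd (pow_ne_zero _ hQ0) (pow_dvd_pow _ k.le_succ)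
    have hn0 := ne_of_mem_of_not_mem hn hF
    have h1 : ({m ∈ S k | ¬ n * m ∈ S k} : Finset ℕ).card ≤ (S (k + 1) \ S k).card := by
      refine Finset.card_le_card_of_injOn (n * ·) (fun m hm ↦ ?_)
        (mul_right_injective₀ hn0).injOn
      simp only [Finset.coe_filter, Set.mem_ofPred_eq] at hm
      refine Finset.mem_coe.mpr (Finset.mem_sdiff.mpr ⟨?_, hm.2⟩)
      refine Nat.mem_divisors.mpr ⟨?_, pow_ne_zero _ hQ0⟩
      rw [pow_succ']
      exact mul_dvd_mul (Finset.dvd_prod_of_mem _ hn) (Nat.dvd_of_mem_divisors hm.1)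
    have h2 := Finset.card_filter_add_card_filter_not (s := S k) (fun m ↦ n * m ∈ S k)
    have h3 := Finset.card_sdiff_add_card_eq_card hsub
    have h4 : 2 * (S k).card ≤ ({m ∈ S k | n * m ∈ S k} : Finset ℕ).card + (S (k + 1)).card := by
      omega
    have h5 : (2 : ℝ) * (S k).card ≤
        ({m ∈ S k | n * m ∈ S k} : Finset ℕ).card + (S (k + 1)).card := by exact_mod_cast h4
    change 2 - ((S (k + 1)).card : ℝ) / (S k).card ≤ _
    rw [sub_le_iff_le_add, ← add_div, le_div_iff₀ (hSpos k)]
    exact h5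
  have hlim' : Tendsto (fun k ↦ ∑ n ∈ F, b n * χ n *
      (((({m ∈ S k | n * m ∈ S k} : Finset ℕ).card : ℝ) / (S k).card : ℝ) : ℂ)) atTop
      (nhds (∑ n ∈ F, b n * χ n * ((1 : ℝ) : ℂ))) :=
    tendsto_finsetSum _ fun n hn ↦ ((continuous_ofReal.tendsto 1).comp (hlim n hn)).const_mul _
  simp only [ofReal_one, mul_one] at hlim'
  refine le_of_tendsto hlim'.norm (.of_forall fun k ↦ ?_)
  have h := norm_sum_mul_card_le_mul_card hmul hsq hF (S := S k) (by simp [S]) b hb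
  have hS0 : ((S k).card : ℂ) ≠ 0 := by exact_mod_cast (hSpos k).ne'
  rw [← mul_le_mul_iff_left₀ (hSpos k)]
  refine le_of_eq_of_le ?_ h
  have hcard : ((S k).card : ℝ) = ‖((S k).card : ℂ)‖ := by simp
  conv_lhs => rw [hcard, ← norm_mul, Finset.sum_mul]
  congr 1
  refine Finset.sum_congr rfl fun n _ ↦ ?_
  simp only [Complex.norm_natCast, ofReal_div, ofReal_natCast]
  field_simp

lemma norm_tsum_mul_le_of_forall_ge {χ : ℕ → ℤ} (hmul : ∀ m n, χ (m * n) = χ m * χ n)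
    (hsq : ∀ n ≠ 0, χ n ^ 2 = 1) {b : ℕ → ℂ} (hb0 : b 0 = 0) (hb : Summable b)
    {B T₀ : ℝ} (hB : ∀ t ≥ T₀, ‖∑' n, b n * cexp (-Real.log n * t * I)‖ ≤ B) :
    ‖∑' n, b n * χ n‖ ≤ B := by
  have hnorm (n : ℕ) (t : ℝ) : ‖b n * cexp (-Real.log n * t * I)‖ = ‖b n‖ := by
    rw [norm_mul, ← ofReal_neg, ← ofReal_mul, norm_exp_ofReal_mul_I, mul_one]
  have hχ (n : ℕ) : ‖b n * χ n‖ ≤ ‖b n‖ := by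
    rcases eq_or_ne n 0 with rfl | hn
    · simp [hb0]
    · rcases sq_eq_one_iff.mp (hsq n hn) with h | h <;> simp [h]
  have hsum : Summable fun n ↦ b n * χ n := .of_norm_bounded hb.norm hχ
  have hlim := (hb.norm.hasSum.const_sub (∑' n, ‖b n‖)).const_add B
  rw [sub_self, add_zero] at hlim
  refine le_of_tendsto_of_tendsto' hsum.hasSum.norm hlim fun F ↦ ?_
  have herase : ∑ n ∈ F, b n * χ n = ∑ n ∈ F.erase 0, b n * χ n :=
    (Finset.sum_erase _ (by simp [hb0])).symm
  rw [herase]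
  refine norm_sum_mul_le_of_forall_ge hmul hsq (by simp) b (T₀ := T₀) fun t ht ↦ ?_
  have hs : Summable fun n ↦ b n * cexp (-Real.log n * t * I) :=
    .of_norm_bounded hb.norm fun n ↦ (hnorm n t).le
  rw [Finset.sum_erase _ (by simp [hb0])]
  have h1 := hs.sum_add_tsum_compl (s := F)
  have h2 := hb.norm.sum_add_tsum_compl (s := F)
  rw [eq_sub_of_add_eq h1]
  refine (norm_sub_le _ _).trans (add_le_add (hB t ht) ?_)
  rw [← h2, add_sub_cancel_left]
  refine (norm_tsum_le_tsum_norm (hs.norm.subtype _)).trans_eq (tsum_congr fun n ↦ hnorm n t)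

lemma exists_norm_le_right_of_line {G : ℂ → ℂ} (hd : DifferentiableOn ℂ G {s | 1 < s.re})
    (hc : ContinuousOn G {s | 1 ≤ s.re ∧ 1 ≤ s.im}) {C A : ℝ}
    (hline : ∀ s : ℂ, s.re = 1 → 1 ≤ s.im → ‖G s‖ ≤ C)
    (hA : ∀ s : ℂ, 1 < s.re → s.re ≤ 2 → ‖G s‖ ≤ A / (s.re - 1)) :
    ∃ B, ∀ s : ℂ, 1 < s.re → s.re < 2 → 2 ≤ s.im → ‖G s‖ ≤ B := by
  refine ⟨max C (3 * A), fun z hz1 hz2 hzi ↦ ?_⟩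
  set T := z.im with hT
  set U : Set ℂ := Set.Ioo 1 2 ×ℂ Set.Ioo (T - 1) (T + 1) with hU
  set w : ℂ → ℂ := fun s ↦ s - 1 - T * I with hw
  have hclU : closure U = Set.Icc 1 2 ×ℂ Set.Icc (T - 1) (T + 1) := by
    rw [hU, closure_reProdIm, closure_Ioo (by norm_num), closure_Ioo (by linarith)]
  have hUo : IsOpen U := isOpen_Ioo.reProdIm isOpen_Ioo
  have hUb : Bornology.IsBounded U :=
    (Metric.isBounded_Ioo _ _).reProdIm (Metric.isBounded_Ioo _ _)
  have hwre (s : ℂ) : (w s ^ 2 + 1).re = (s.re - 1) ^ 2 - (s.im - T) ^ 2 + 1 := by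
    simp [hw, sq]
  have hwim (s : ℂ) : (w s ^ 2 + 1).im = 2 * (s.re - 1) * (s.im - T) := by
    simp [hw, sq]
    ring
  have hdiff : DiffContOnCl ℂ (fun s ↦ G s * (w s ^ 2 + 1)) U := by
    refine ⟨(hd.mono fun s hs ↦ hs.1.1).mul (by fun_prop), ?_⟩
    rw [hclU]
    refine (hc.mono fun s hs ↦ ⟨hs.1.1, ?_⟩).mul (by fun_prop)
    linarith [hs.2.1]
  have hfr : ∀ s ∈ frontier U, ‖G s * (w s ^ 2 + 1)‖ ≤ max C (3 * A) := by
    intro s hs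
    rw [frontier, hUo.interior_eq, hclU] at hs
    obtain ⟨⟨⟨h1, h2⟩, h3, h4⟩, hnot⟩ := hs
    rw [norm_mul]
    have hy : (s.im - T) ^ 2 ≤ 1 := by
      rw [sq_le_one_iff_abs_le_one, abs_le]
      constructor <;> linarith
    rcases h1.eq_or_lt with h1 | h1
    · have hG := hline s h1.symm (by linarith)
      have h5 : ‖w s ^ 2 + 1‖ ≤ 1 := by
        rw [← sq_le_one_iff₀ (norm_nonneg _), Complex.sq_norm, normSq_apply, hwre, hwim, ← h1]
        nlinarith [sq_nonneg (s.im - T)]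
      exact (mul_le_of_le_one_right (norm_nonneg _) h5).trans (hG.trans (le_max_left _ _))
    · have hG := hA s h1 h2
      have hx : 0 < s.re - 1 := by linarith
      have h5 : ‖w s ^ 2 + 1‖ ≤ 3 * (s.re - 1) := by
        refine abs_le_of_sq_le_sq' ?_ (by positivity) |>.2
        rw [Complex.sq_norm, normSq_apply, hwre, hwim]
        have hor : s.re = 2 ∨ (s.im - T) ^ 2 = 1 := by
          by_contra! hcon
          refine hnot ⟨⟨h1, lt_of_le_of_ne h2 hcon.1⟩, ?_⟩
          have h6 : |s.im - T| < 1 := by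
            rw [← sq_lt_one_iff_abs_lt_one]
            exact lt_of_le_of_ne hy hcon.2
          rw [abs_lt] at h6
          constructor <;> linarith
        set x := s.re - 1
        set y := s.im - T
        have hx1 : x ≤ 1 := by simp only [x]; linarith
        rcases hor with h | h
        · have : x = 1 := by simp only [x]; rw [h]; norm_num
          rw [this]
          nlinarith [sq_nonneg y]
        · rw [h]
          have e : (2 * x * y) * (2 * x * y) = 4 * x ^ 2 := by
            linear_combination 4 * x ^ 2 * h
          rw [e]
          nlinarith [mul_nonneg (sq_nonneg x) (by nlinarith : 0 ≤ 1 - x ^ 2)]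
      calc _ ≤ A / (s.re - 1) * (3 * (s.re - 1)) := by
            gcongr
            exact (norm_nonneg _).trans hG
        _ = 3 * A := by field_simp
        _ ≤ _ := le_max_right _ _
  have hzU : z ∈ closure U := by
    rw [hclU]
    exact ⟨⟨hz1.le, hz2.le⟩, by simp [← hT]⟩
  have h := Complex.norm_le_of_forall_mem_frontier_norm_le hUb hdiff hfr hzU
  rw [norm_mul] at h
  refine le_trans (le_mul_of_one_le_right (norm_nonneg _) ?_) h
  refine le_trans ?_ (abs_re_le_norm _)
  rw [hwre, ← hT, sub_self]
  refine le_trans ?_ (le_abs_self _)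
  nlinarith [sq_nonneg (z.re - 1)]

lemma not_exists_norm_integral_riemannZeta_le {δ : ℝ} (hδ : 0 < δ) :
    ¬ ∃ B, ∀ ε : ℝ, 0 < ε → ε < 1 → ‖∫ t in (0 : ℝ)..δ, riemannZeta ((1 + ε : ℝ) + t * I)‖ ≤ B := by
  rintro ⟨B, hB⟩
  obtain ⟨M, hM⟩ := (isCompact_Icc (a := ((0 : ℝ), (0 : ℝ)))
    (b := (1, δ))).exists_bound_of_continuousOn
    (f := fun z : ℝ × ℝ ↦ riemannZeta₀ ((1 + z.1 : ℝ) + z.2 * I))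
    (differentiable_riemannZeta₀.continuous.comp (by fun_prop)).continuousOn
  have hlog (ε : ℝ) (h0 : 0 < ε) (h1 : ε < 1) : Real.log (δ / ε) ≤ B + M * δ := by
    have hsl (t : ℝ) : (ε + t * I : ℂ) ∈ slitPlane := .inl (by simpa)
    have hder (t : ℝ) : HasDerivAt (fun t : ℝ ↦ Complex.log (ε + t * I))
        (I / (ε + t * I)) t := by
      have : HasDerivAt (fun t : ℝ ↦ (ε + t * I : ℂ)) I t := by
        simpa using ((hasDerivAt_id t).ofReal_comp.mul_const I).const_add (ε : ℂ)
      exact this.clog_real (hsl t)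
    have hcont : Continuous fun t : ℝ ↦ I / (ε + t * I : ℂ) :=
      continuous_const.div (by fun_prop) fun t ↦ slitPlane_ne_zero (hsl t)
    have hcont₀ : Continuous fun t : ℝ ↦ riemannZeta₀ ((1 + ε : ℝ) + t * I) :=
      differentiable_riemannZeta₀.continuous.comp (by fun_prop)
    have hftc := intervalIntegral.integral_eq_sub_of_hasDerivAt (a := 0) (b := δ)
      (fun t _ ↦ hder t) (hcont.intervalIntegrable _ _)
    have hz (t : ℝ) : I * riemannZeta ((1 + ε : ℝ) + t * I) =
        I / (ε + t * I) + I * riemannZeta₀ ((1 + ε : ℝ) + t * I) := by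
      have hne : ((1 + ε : ℝ) + t * I : ℂ) - 1 = ε + t * I := by push_cast; ring
      rw [riemannZeta_eq_inv_sub_add (sub_ne_zero.mp (hne ▸ slitPlane_ne_zero (hsl t))), hne]
      ring
    have hint : Complex.log (ε + δ * I) - Complex.log ε =
        I * (∫ t in (0 : ℝ)..δ, riemannZeta ((1 + ε : ℝ) + t * I)) -
        I * ∫ t in (0 : ℝ)..δ, riemannZeta₀ ((1 + ε : ℝ) + t * I) := by
      rw [← intervalIntegral.integral_const_mul, ← intervalIntegral.integral_const_mul]
      simp_rw [hz]
      rw [intervalIntegral.integral_add (hcont.intervalIntegrable _ _)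
        ((hcont₀.const_mul _).intervalIntegrable _ _), hftc]
      simp
    have hbd : ‖∫ t in (0 : ℝ)..δ, riemannZeta₀ ((1 + ε : ℝ) + t * I)‖ ≤ M * δ := by
      refine (intervalIntegral.norm_integral_le_of_norm_le_const fun t ht ↦ ?_).trans_eq
        (by rw [sub_zero, abs_of_pos hδ])
      rw [Set.uIoc_of_le hδ.le] at ht
      exact hM (ε, t) ⟨⟨h0.le, ht.1.le⟩, h1.le, ht.2⟩
    have hnorm : ‖Complex.log (ε + δ * I) - Complex.log ε‖ ≤ B + M * δ := by
      rw [hint]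
      refine (norm_sub_le _ _).trans ?_
      simp only [norm_mul, norm_I, one_mul]
      exact add_le_add (hB ε h0 h1) hbd
    refine le_trans ?_ ((le_abs_self _).trans ((abs_re_le_norm _).trans hnorm))
    rw [sub_re, log_re, log_re, Complex.norm_of_nonneg h0.le, Real.log_div hδ.ne' h0.ne']
    gcongr
    simpa using abs_im_le_norm (ε + δ * I) |>.trans' (le_abs_self _)
  set x := min (-1) (Real.log δ - (B + M * δ) - 1) with hx
  have h := hlog (Real.exp x) (Real.exp_pos x) (by
    rw [← Real.exp_zero, Real.exp_lt_exp]
    linarith [min_le_left (-1) (Real.log δ - (B + M * δ) - 1)])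
  rw [Real.log_div hδ.ne' (Real.exp_pos x).ne', Real.log_exp] at h
  linarith [min_le_right (-1) (Real.log δ - (B + M * δ) - 1)]

lemma LSeries_term_add_mul_I (a : ℕ → ℂ) (s : ℂ) (t : ℝ) (n : ℕ) :
    LSeries.term a (s + t * I) n = LSeries.term a s n * cexp (-Real.log n * t * I) := by
  rcases eq_or_ne n 0 with rfl | hn
  · simp
  · have hn' : (n : ℂ) ≠ 0 := by exact_mod_cast hn
    rw [LSeries.term_of_ne_zero hn, LSeries.term_of_ne_zero hn, cpow_add _ _ hn',
      cpow_def_of_ne_zero hn' (t * I), natCast_log, ← div_div, div_eq_mul_inv (_ / _),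
      ← Complex.exp_neg]
    ring_nf

lemma norm_LSeries_le_norm_riemannZeta {a : ℕ → ℂ} (ha : ∀ n ≠ 0, ‖a n‖ ≤ 1) {s : ℂ}
    (hs : 1 < s.re) : ‖LSeries a s‖ ≤ ‖riemannZeta s.re‖ := by
  have h1 : LSeriesSummable 1 (s.re : ℂ) := LSeriesSummable_one_iff.mpr (by simpa)
  have hterm (n : ℕ) : LSeries.term 1 (s.re : ℂ) n = (‖LSeries.term 1 (s.re : ℂ) n‖ : ℂ) := by
    rcases eq_or_ne n 0 with rfl | hn
    · simp
    · rw [LSeries.norm_term_eq, if_neg hn, LSeries.term_of_ne_zero hn]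
      simp [ofReal_cpow]
  rw [← LSeries_one_eq_riemannZeta (by simpa), LSeries, LSeries, tsum_congr hterm, ← ofReal_tsum,
    Complex.norm_of_nonneg (tsum_nonneg fun _ ↦ norm_nonneg _)]
  refine tsum_of_norm_bounded h1.norm.hasSum fun n ↦ ?_
  rw [LSeries.norm_term_eq, LSeries.norm_term_eq]
  split_ifs with hn
  · rfl
  · simp only [Pi.one_apply, norm_one, ofReal_re]
    gcongr
    exact ha n hn

lemma integral_LSeries_add_mul_I {a : ℕ → ℂ} (ha : ∀ n ≠ 0, ‖a n‖ ≤ 1) {s : ℂ} (hs : 1 < s.re)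
    (δ : ℝ) : ∫ t in (0 : ℝ)..δ, LSeries a (s + t * I) =
      LSeries (fun n ↦ a n * ∫ t in (0 : ℝ)..δ, cexp (-Real.log n * t * I)) s := by
  have hsum := (LSeriesSummable_of_bounded_of_one_lt_re ha hs).norm
  have h := intervalIntegral.tsum_intervalIntegral_eq_of_summable_norm (a := 0) (b := δ)
    (f := fun n : ℕ ↦ (⟨fun t : ℝ ↦ LSeries.term a s n * cexp (-Real.log n * t * I),
      by fun_prop⟩ : C(ℝ, ℂ))) (hsum.of_nonneg_of_le (fun _ ↦ norm_nonneg _) fun n ↦ ?_)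
  · simp only [ContinuousMap.coe_mk] at h
    simp only [LSeries, LSeries_term_add_mul_I]
    rw [← h]
    refine tsum_congr fun n ↦ ?_
    rw [intervalIntegral.integral_const_mul, LSeries.term_def, LSeries.term_def]
    split_ifs
    · simp
    · ring
  · refine (ContinuousMap.norm_le _ (norm_nonneg _)).mpr fun t ↦ ?_
    simp only [ContinuousMap.restrict_apply, ContinuousMap.coe_mk]
    rw [norm_mul, ← ofReal_neg, ← ofReal_mul, norm_exp_ofReal_mul_I, mul_one]

lemma norm_integral_cexp_le {δ : ℝ} (hδ : 0 < δ) (x : ℝ) :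
    ‖∫ t in (0 : ℝ)..δ, cexp (-x * t * I)‖ ≤ δ := by
  refine (intervalIntegral.norm_integral_le_of_norm_le_const (C := 1) fun t _ ↦ ?_).trans_eq
    (by rw [sub_zero, abs_of_pos hδ, one_mul])
  rw [← ofReal_neg, ← ofReal_mul, norm_exp_ofReal_mul_I]

lemma continuousOn_integral_vertical {f : ℂ → ℂ}
    (hf : ContinuousOn f {s | 1 ≤ s.re ∧ 1 ≤ s.im}) {δ : ℝ} (hδ : 0 < δ) :
    ContinuousOn (fun s ↦ ∫ t in (0 : ℝ)..δ, f (s + t * I)) {s | 1 ≤ s.re ∧ 1 ≤ s.im} := by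
  have h : Continuous fun s : ℂ ↦
      ∫ t in (0 : ℝ)..δ, f ((max s.re 1 : ℝ) + (max (s.im + t) 1 : ℝ) * I) := by
    refine continuous_parametric_intervalIntegral_of_continuous'
      (f := fun (s : ℂ) (t : ℝ) ↦ f ((max s.re 1 : ℝ) + (max (s.im + t) 1 : ℝ) * I)) ?_ _ _
    refine hf.comp_continuous (f := fun z : ℂ × ℝ ↦
      ((max z.1.re 1 : ℝ) + (max (z.1.im + z.2) 1 : ℝ) * I : ℂ)) (by fun_prop) fun z ↦ ?_
    simp
  refine h.continuousOn.congr fun s hs ↦ intervalIntegral.integral_congr fun t ht ↦ ?_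
  rw [Set.uIcc_of_le hδ.le] at ht
  have h1 : max s.re 1 = s.re := max_eq_left hs.1
  have h2 : max (s.im + t) 1 = s.im + t := max_eq_left (by linarith [hs.2, ht.1])
  simp only [h1, h2]
  congr 1
  apply Complex.ext <;> simp

lemma not_forall_integral_norm_le {χ : ℕ → ℤ} (hmul : ∀ m n, χ (m * n) = χ m * χ n)
    (hsq : ∀ n ≠ 0, χ n ^ 2 = 1) {f : ℂ → ℂ} (hf : ContinuousOn f {s | 1 ≤ s.re ∧ 1 ≤ s.im})
    (hfχ : ∀ s : ℂ, 1 < s.re → f s = LSeries (fun n ↦ (χ n : ℂ)) s) {δ : ℝ} (hδ : 0 < δ) (C : ℝ) :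
    ¬ ∀ T : ℝ, 1 ≤ T → ∫ t in T..(T + δ), ‖f (1 + t * I)‖ ≤ C := by
  intro hC
  have hχ (n : ℕ) (hn : n ≠ 0) : ‖(χ n : ℂ)‖ ≤ 1 := by
    rcases sq_eq_one_iff.mp (hsq n hn) with h | h <;> simp [h]
  have hχχ (n : ℕ) (hn : n ≠ 0) : (χ n : ℂ) * χ n = 1 := by
    rw [← sq]; exact_mod_cast hsq n hn
  obtain ⟨K, -, hK⟩ := exists_norm_riemannZeta_ofReal_le
  set k : ℕ → ℂ := fun n ↦ ∫ t in (0 : ℝ)..δ, cexp (-Real.log n * t * I) with hk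
  have hkδ (n : ℕ) : ‖k n‖ ≤ δ := norm_integral_cexp_le hδ _
  have hχk (n : ℕ) (hn : n ≠ 0) : ‖(χ n : ℂ) * k n‖ ≤ δ := by
    rw [norm_mul]
    exact (mul_le_of_le_one_left (norm_nonneg _) (hχ n hn)).trans (hkδ n)
  set G : ℂ → ℂ := fun s ↦ ∫ t in (0 : ℝ)..δ, f (s + t * I) with hG
  have hGL (s : ℂ) (hs : 1 < s.re) : G s = LSeries (fun n ↦ (χ n : ℂ) * k n) s := by
    rw [hG, ← integral_LSeries_add_mul_I hχ hs]
    exact intervalIntegral.integral_congr fun t _ ↦ hfχ _ (by simpa)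
  have hd : DifferentiableOn ℂ G {s | 1 < s.re} := by
    refine ((LSeries_differentiableOn _).mono fun s hs ↦ ?_).congr hGL
    refine lt_of_le_of_lt (LSeries.abscissaOfAbsConv_le_of_le_const ⟨δ, hχk⟩) ?_
    exact_mod_cast hs
  have hline (s : ℂ) (hs : s.re = 1) (hi : 1 ≤ s.im) : ‖G s‖ ≤ C := by
    refine (intervalIntegral.norm_integral_le_integral_norm hδ.le).trans
      (le_of_eq_of_le ?_ (hC s.im hi))
    have := intervalIntegral.integral_comp_add_left (a := 0) (b := δ)
      (fun t : ℝ ↦ ‖f (1 + t * I)‖) s.im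
    rw [add_zero] at this
    rw [← this]
    refine intervalIntegral.integral_congr fun t _ ↦ ?_
    congr 2
    apply Complex.ext <;> simp [hs]
  have hA (s : ℂ) (h1 : 1 < s.re) (h2 : s.re ≤ 2) : ‖G s‖ ≤ K * δ / (s.re - 1) := by
    refine (intervalIntegral.norm_integral_le_of_norm_le_const
      (C := K / (s.re - 1)) fun t _ ↦ ?_).trans_eq (by rw [sub_zero, abs_of_pos hδ]; ring)
    have hre : (s + t * I).re = s.re := by simp
    rw [hfχ _ (by rwa [hre])]
    refine (norm_LSeries_le_norm_riemannZeta hχ (by rwa [hre])).trans ?_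
    rw [hre]
    exact hK _ h1 h2
  obtain ⟨B, hB⟩ := exists_norm_le_right_of_line hd (continuousOn_integral_vertical hf hδ) hline hA
  refine not_exists_norm_integral_riemannZeta_le hδ ⟨B, fun ε h0 h1 ↦ ?_⟩
  set σ : ℂ := ((1 + ε : ℝ) : ℂ) with hσ
  have hσ1 : 1 < σ.re := by simpa [hσ] using h0
  set b : ℕ → ℂ := LSeries.term (fun n ↦ (χ n : ℂ) * k n) σ with hb
  have hsum : Summable b := LSeriesSummable_of_bounded_of_one_lt_re hχk hσ1
  have hmean := norm_tsum_mul_le_of_forall_ge hmul hsq (b := b) (by simp [hb]) hsum (B := B)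
    (T₀ := 2) fun t ht ↦ ?_
  · refine le_of_eq_of_le ?_ hmean
    congr 1
    have hζ : ∫ t in (0 : ℝ)..δ, riemannZeta (σ + t * I) =
        ∫ t in (0 : ℝ)..δ, LSeries 1 (σ + t * I) :=
      intervalIntegral.integral_congr fun t _ ↦ (LSeries_one_eq_riemannZeta (by simpa)).symm
    rw [hζ, integral_LSeries_add_mul_I (by simp) hσ1, LSeries]
    refine tsum_congr fun n ↦ ?_
    rcases eq_or_ne n 0 with rfl | hn
    · simp [hb]
    · rw [hb, LSeries.term_of_ne_zero hn, LSeries.term_of_ne_zero hn, div_mul_eq_mul_div,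
        mul_right_comm, hχχ n hn]
      rfl
  · have h := hB (σ + t * I) (by simpa) (by simp [hσ]; linarith) (by simpa [hσ] using ht)
    rw [hGL _ (by simpa), LSeries] at h
    simpa only [LSeries_term_add_mul_I] using h

lemma LSeries_liouville_eq {s : ℂ} (hs : 1 < s.re) :
    LSeries (fun n ↦ (ArithmeticFunction.liouville n : ℂ)) s =
      riemannZeta (2 * s) / riemannZeta s := by
  have hs0 : s ≠ 0 := ne_zero_of_one_lt_re hs
  set g : ℕ →*₀ ℂ :=
    { toFun := fun n ↦ (ArithmeticFunction.liouville n : ℂ) * riemannZetaSummandHom hs0 n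
      map_zero' := by simp
      map_one' := by simp [ArithmeticFunction.liouville_apply_one]
      map_mul' := fun m n ↦ by
        simp only [ArithmeticFunction.liouville_apply_mul, map_mul, Int.cast_mul]
        ring } with hg
  have hsum : Summable fun n ↦ ‖g n‖ := by
    refine (summable_riemannZetaSummand hs).of_nonneg_of_le (fun _ ↦ norm_nonneg _) fun n ↦ ?_
    change ‖(ArithmeticFunction.liouville n : ℂ) * riemannZetaSummandHom hs0 n‖ ≤ _
    rcases eq_or_ne n 0 with rfl | hn
    · simp
    · simp [ArithmeticFunction.liouville_apply hn]
  have hgL : ∑' n, g n = LSeries (fun n ↦ (ArithmeticFunction.liouville n : ℂ)) s := by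
    refine tsum_congr fun n ↦ ?_
    change (ArithmeticFunction.liouville n : ℂ) * (n : ℂ) ^ (-s) = _
    rcases eq_or_ne n 0 with rfl | hn
    · simp
    · rw [LSeries.term_of_ne_zero hn, cpow_neg, div_eq_mul_inv]
  have h1 := (EulerProduct.eulerProduct_completely_multiplicative_hasProd hsum).mul
    (riemannZeta_eulerProduct_hasProd hs)
  have h2 := riemannZeta_eulerProduct_hasProd (s := 2 * s) (by simp; linarith)
  have hfactor (p : Nat.Primes) : (1 - g p)⁻¹ * (1 - (p : ℂ) ^ (-s))⁻¹ =
      (1 - (p : ℂ) ^ (-(2 * s)))⁻¹ := by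
    have hgp : g p = -(p : ℂ) ^ (-s) := by
      change (ArithmeticFunction.liouville p : ℂ) * (p : ℂ) ^ (-s) = _
      rw [ArithmeticFunction.liouville_apply p.prop.ne_zero,
        ArithmeticFunction.cardFactors_apply_prime p.prop]
      simp
    have hsq : (p : ℂ) ^ (-(2 * s)) = ((p : ℂ) ^ (-s)) ^ 2 := by
      rw [← cpow_nat_mul]
      push_cast
      ring_nf
    rw [hgp, hsq, ← mul_inv]
    ring_nf
  simp_rw [hfactor] at h1
  rw [eq_div_iff (riemannZeta_ne_zero_of_one_lt_re hs), ← hgL]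
  exact h1.unique h2

lemma continuousOn_riemannZeta_two_mul_div :
    ContinuousOn (fun s ↦ riemannZeta (2 * s) / riemannZeta s) {s | 1 ≤ s.re ∧ 1 ≤ s.im} := by
  refine ContinuousOn.div (continuousOn_riemannZeta_of_one_le.comp (by fun_prop) fun s hs ↦ ?_)
    continuousOn_riemannZeta_of_one_le fun s hs ↦ riemannZeta_ne_zero_of_one_le_re hs.1
  simp only [Set.mem_ofPred_eq, mul_re, re_ofNat, im_ofNat, mul_im] at hs ⊢
  constructor <;> linarith

lemma not_forall_integral_norm_riemannZeta_rpow_le_of_norm_le {χ : ℕ → ℤ}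
    (hmul : ∀ m n, χ (m * n) = χ m * χ n) (hsq : ∀ n ≠ 0, χ n ^ 2 = 1) {f : ℂ → ℂ}
    (hf : ContinuousOn f {s | 1 ≤ s.re ∧ 1 ≤ s.im})
    (hfχ : ∀ s : ℂ, 1 < s.re → f s = LSeries (fun n ↦ (χ n : ℂ)) s) {A p : ℝ}
    (hA : ∀ t : ℝ, 1 ≤ t → ‖f (1 + t * I)‖ ≤ A * (1 + ‖riemannZeta (1 + t * I)‖ ^ p))
    {δ : ℝ} (hδ : 0 < δ) (C : ℝ) :
    ¬ ∀ T : ℝ, 1 ≤ T → ∫ t in T..(T + δ), ‖riemannZeta (1 + t * I)‖ ^ p ≤ C := by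
  intro hC
  have hA0 : 0 ≤ A := by
    by_contra! h
    have := (norm_nonneg _).trans (hA 1 le_rfl)
    have h2 : 0 ≤ ‖riemannZeta (1 + (1 : ℝ) * I)‖ ^ p := by positivity
    nlinarith
  refine not_forall_integral_norm_le hmul hsq hf hfχ hδ (A * (δ + C)) fun T hT ↦ ?_
  have hmaps : Set.MapsTo (fun t : ℝ ↦ (1 + t * I : ℂ)) (Set.uIcc T (T + δ))
      {s | 1 ≤ s.re ∧ 1 ≤ s.im} := fun t ht ↦ by
    rw [Set.uIcc_of_le (by linarith)] at ht
    simpa using hT.trans ht.1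
  have hint1 : IntervalIntegrable (fun t : ℝ ↦ ‖f (1 + t * I)‖) volume T (T + δ) :=
    (hf.norm.comp (by fun_prop) hmaps).intervalIntegrable
  have hint2 : IntervalIntegrable (fun t : ℝ ↦ ‖riemannZeta (1 + t * I)‖ ^ p) volume T (T + δ) :=
    ((continuousOn_norm_riemannZeta_rpow p).comp (by fun_prop) hmaps).intervalIntegrable
  have hint3 := (_root_.intervalIntegrable_const (c := (1 : ℝ))).add hint2
  calc _ ≤ ∫ t in T..(T + δ), A * (1 + ‖riemannZeta (1 + t * I)‖ ^ p) :=
        intervalIntegral.integral_mono_on (by linarith) hint1 (hint3.const_mul A)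
          fun t ht ↦ hA t (hT.trans ht.1)
    _ = A * (δ + ∫ t in T..(T + δ), ‖riemannZeta (1 + t * I)‖ ^ p) := by
        rw [intervalIntegral.integral_const_mul,
          intervalIntegral.integral_add _root_.intervalIntegrable_const hint2]
        simp
    _ ≤ _ := by
        gcongr
        exact hC T hT

lemma not_forall_integral_norm_riemannZeta_rpow_le {δ : ℝ} (hδ : 0 < δ) {p : ℝ} (hp : 1 ≤ |p|)
    (C : ℝ) : ¬ ∀ T : ℝ, 1 ≤ T → ∫ t in T..(T + δ), ‖riemannZeta (1 + t * I)‖ ^ p ≤ C := by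
  have hle {x r : ℝ} (hx : 0 ≤ x) (hr : 1 ≤ r) : x ≤ 1 + x ^ r := by
    rcases le_total x 1 with h | h
    · linarith [Real.rpow_nonneg hx r]
    · linarith [Real.self_le_rpow_of_one_le h hr]
  rcases le_abs'.mp hp with hp | hp
  · refine not_forall_integral_norm_riemannZeta_rpow_le_of_norm_le
      (χ := ArithmeticFunction.liouville) ArithmeticFunction.liouville_apply_mul (fun n hn ↦ ?_)
      continuousOn_riemannZeta_two_mul_div (fun s hs ↦ (LSeries_liouville_eq hs).symm)
      (A := ‖riemannZeta (2 : ℝ)‖) (fun t ht ↦ ?_) hδ C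
    · rw [ArithmeticFunction.liouville_apply hn, ← pow_mul, mul_comm, pow_mul]
      simp
    · have hre : (2 * (1 + t * I) : ℂ).re = 2 := by simp
      have h2 := norm_LSeries_le_norm_riemannZeta (a := 1) (by simp)
        (s := 2 * (1 + t * I)) (by rw [hre]; norm_num)
      rw [LSeries_one_eq_riemannZeta (by rw [hre]; norm_num), hre] at h2
      have h3 := hle (inv_nonneg.mpr (norm_nonneg (riemannZeta (1 + t * I)))) (r := -p)
        (by linarith)
      rw [Real.inv_rpow (norm_nonneg _), Real.rpow_neg (norm_nonneg _), inv_inv] at h3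
      rw [norm_div, div_eq_mul_inv]
      gcongr
  · exact not_forall_integral_norm_riemannZeta_rpow_le_of_norm_le (χ := 1) (by simp) (by simp)
      continuousOn_riemannZeta_of_one_le (fun s hs ↦ by
        rw [← LSeries_one_eq_riemannZeta hs]
        exact LSeries_congr (by simp) s)
      (A := 1) (fun t _ ↦ by rw [one_mul]; exact hle (norm_nonneg _) hp) hδ C

theorem stmt_2 (δ : ℝ) (hδ : 0 < δ) (p : ℝ) :
    (⨆ T ∈ Set.Ici (1 : ℝ),
        ((∫ t in T..(T + δ), ‖riemannZeta (1 + t * Complex.I)‖ ^ p : ℝ) : EReal)) < ⊤ ↔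
      (-1 < p ∧ p < 1) := by
  rw [← abs_lt]
  constructor
  · intro h
    by_contra! hp
    obtain ⟨C, hC, -⟩ := EReal.lt_iff_exists_real_btwn.mp h
    refine not_forall_integral_norm_riemannZeta_rpow_le hδ hp C fun T hT ↦ ?_
    exact EReal.coe_le_coe_iff.mp ((le_iSup₂ (f := fun (T : ℝ) (_ : T ∈ Set.Ici (1 : ℝ)) ↦
      ((∫ t in T..(T + δ), ‖riemannZeta (1 + t * I)‖ ^ p : ℝ) : EReal)) T hT).trans hC.le)
  · intro hp
    obtain ⟨C, hC⟩ := exists_integral_norm_riemannZeta_one_rpow_le hδ hp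
    exact (iSup₂_le fun T hT ↦ EReal.coe_le_coe_iff.mpr (hC T hT)).trans_lt (EReal.coe_lt_top C)
end

section
/- Let σ ∈ ℝ, let a : ℕ≥1 → ℂ be such that Σ_{n=1}^∞ |a(n)| n^{−σ} converges, and suppose a(n) = |a(n)| b(n) for all n, where b is a completely multiplicative arithmetical function with |b(n)| = 1 for all n. Write L(σ+it) = Σ_{n=1}^∞ a(n) n^{−σ−it} and L̃(σ+it) = Σ_{n=1}^∞ |a(n)| n^{−σ−it}. Then for every δ > 0, limsup_{T → ∞} ∫_{−δ}^{δ} |L(σ+i(T+t))|² (δ − |t|) dt = ∫_{−δ}^{δ} |L̃(σ+it)|² (δ − |t|) dt, and the same identity holds with limsup_{T→∞} replaced by sup over all real T. -/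
open Complex Real Filter MeasureTheory intervalIntegral
open scoped ComplexConjugate Topology

theorem integral_cos_mul_sub_nonneg (x : ℝ) {δ : ℝ} (hδ : 0 < δ) :
    0 ≤ ∫ t in (0 : ℝ)..δ, Real.cos (x * t) * (δ - t) := by
  rcases eq_or_ne x 0 with rfl | hx
  · refine intervalIntegral.integral_nonneg hδ.le fun t ht => ?_
    simpa using ht.2
  · have hderiv : ∀ t ∈ Set.uIcc 0 δ,
        HasDerivAt (fun t => (δ - t) * Real.sin (x * t) / x - Real.cos (x * t) / x ^ 2)
          (Real.cos (x * t) * (δ - t)) t := by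
      intro t _
      have h1 : HasDerivAt (fun t : ℝ => x * t) x t := by
        simpa using (hasDerivAt_id t).const_mul x
      have h2 : HasDerivAt (fun t : ℝ => δ - t) (-1) t := by
        simpa using (hasDerivAt_id t).const_sub δ
      refine (((h2.mul h1.sin).div_const x).sub (h1.cos.div_const (x ^ 2))).congr_deriv ?_
      field_simp
      ring
    rw [intervalIntegral.integral_eq_sub_of_hasDerivAt hderiv
      (Continuous.intervalIntegrable (by fun_prop) _ _)]
    have : (δ - δ) * Real.sin (x * δ) / x - Real.cos (x * δ) / x ^ 2 -
        ((δ - 0) * Real.sin (x * 0) / x - Real.cos (x * 0) / x ^ 2) =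
        (1 - Real.cos (x * δ)) / x ^ 2 := by
      simp
      ring
    rw [this]
    exact div_nonneg (sub_nonneg.2 (Real.cos_le_one _)) (sq_nonneg x)

theorem integral_cos_mul_sub_abs_nonneg (x : ℝ) {δ : ℝ} (hδ : 0 < δ) :
    0 ≤ ∫ t in (-δ)..δ, Real.cos (x * t) * (δ - |t|) := by
  have hi : ∀ u v : ℝ, IntervalIntegrable (fun t => Real.cos (x * t) * (δ - |t|)) volume u v :=
    fun u v => Continuous.intervalIntegrable (by fun_prop) _ _
  have hpos : ∫ t in (0 : ℝ)..δ, Real.cos (x * t) * (δ - |t|) =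
      ∫ t in (0 : ℝ)..δ, Real.cos (x * t) * (δ - t) := by
    refine intervalIntegral.integral_congr fun t ht => ?_
    rw [Set.uIcc_of_le hδ.le] at ht
    simp only [abs_of_nonneg ht.1]
  have hneg : ∫ t in (-δ)..0, Real.cos (x * t) * (δ - |t|) =
      ∫ t in (0 : ℝ)..δ, Real.cos (x * t) * (δ - |t|) := by
    have := intervalIntegral.integral_comp_neg (a := 0) (b := δ)
      (fun t : ℝ => Real.cos (x * t) * (δ - |t|))
    simpa using this.symm
  rw [← intervalIntegral.integral_add_adjacent_intervals (hi (-δ) 0) (hi 0 δ), hneg, hpos]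
  exact add_nonneg (integral_cos_mul_sub_nonneg x hδ) (integral_cos_mul_sub_nonneg x hδ)

theorem integral_sin_mul_sub_abs (x δ : ℝ) :
    ∫ t in (-δ)..δ, Real.sin (x * t) * (δ - |t|) = 0 := by
  have := intervalIntegral.integral_comp_neg (a := -δ) (b := δ)
    (fun t : ℝ => Real.sin (x * t) * (δ - |t|))
  simp only [mul_neg, Real.sin_neg, abs_neg, neg_mul, neg_neg,
    intervalIntegral.integral_neg] at this
  linarith

/-- The real part of the Fejér transform picks out a nonnegative multiple of `Re w`. -/
theorem integral_re_mul_exp (w : ℂ) (x δ : ℝ) :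
    ∫ t in (-δ)..δ, (w * cexp ((x * t : ℝ) * I)).re * (δ - |t|) =
      w.re * ∫ t in (-δ)..δ, Real.cos (x * t) * (δ - |t|) := by
  have h : ∀ t : ℝ, (w * cexp ((x * t : ℝ) * I)).re * (δ - |t|) =
      w.re * (Real.cos (x * t) * (δ - |t|)) - w.im * (Real.sin (x * t) * (δ - |t|)) := by
    intro t
    rw [Complex.mul_re, Complex.exp_ofReal_mul_I_re, Complex.exp_ofReal_mul_I_im]
    ring
  simp_rw [h]
  rw [intervalIntegral.integral_sub, intervalIntegral.integral_const_mul,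
    intervalIntegral.integral_const_mul, integral_sin_mul_sub_abs]
  · simp
  all_goals exact Continuous.intervalIntegrable (by fun_prop) _ _

theorem sq_norm_sum_exp {ι : Type*} (S : Finset ι) (v : ι → ℂ) (l : ι → ℝ) (t : ℝ) :
    ‖∑ n ∈ S, v n * cexp ((l n * t : ℝ) * I)‖ ^ 2 =
      ∑ m ∈ S, ∑ n ∈ S, (v m * conj (v n) * cexp (((l m - l n) * t : ℝ) * I)).re := by
  have h : (∑ n ∈ S, v n * cexp ((l n * t : ℝ) * I)) *
      conj (∑ n ∈ S, v n * cexp ((l n * t : ℝ) * I)) =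
      ∑ m ∈ S, ∑ n ∈ S, v m * conj (v n) * cexp (((l m - l n) * t : ℝ) * I) := by
    rw [map_sum, Finset.sum_mul_sum]
    refine Finset.sum_congr rfl fun m _ => Finset.sum_congr rfl fun n _ => ?_
    have : (((l m - l n) * t : ℝ) : ℂ) * I = (l m * t : ℝ) * I + conj ((l n * t : ℝ) * I) := by
      simp only [map_mul, Complex.conj_I, Complex.conj_ofReal]
      push_cast
      ring
    rw [this, Complex.exp_add, Complex.exp_conj, map_mul]
    ring
  rw [Complex.mul_conj'] at h
  have := congrArg Complex.re h
  simp only [Complex.re_sum] at this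
  rw [← this]
  norm_cast

theorem integral_sq_norm_sum_le {ι : Type*} (S : Finset ι) (c : ι → ℝ) (hc : ∀ n, 0 ≤ c n)
    (z : ι → ℂ) (hz : ∀ n, ‖z n‖ = 1) (l : ι → ℝ) {δ : ℝ} (hδ : 0 < δ) :
    ∫ t in (-δ)..δ, ‖∑ n ∈ S, c n * z n * cexp ((l n * t : ℝ) * I)‖ ^ 2 * (δ - |t|) ≤
      ∫ t in (-δ)..δ, ‖∑ n ∈ S, (c n : ℂ) * cexp ((l n * t : ℝ) * I)‖ ^ 2 * (δ - |t|) := by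
  have key : ∀ v : ι → ℂ,
      ∫ t in (-δ)..δ, ‖∑ n ∈ S, v n * cexp ((l n * t : ℝ) * I)‖ ^ 2 * (δ - |t|) =
      ∑ m ∈ S, ∑ n ∈ S, (v m * conj (v n)).re *
        ∫ t in (-δ)..δ, Real.cos ((l m - l n) * t) * (δ - |t|) := by
    intro v
    simp_rw [sq_norm_sum_exp, Finset.sum_mul]
    rw [intervalIntegral.integral_finsetSum]
    · refine Finset.sum_congr rfl fun m _ => ?_
      rw [intervalIntegral.integral_finsetSum]
      · exact Finset.sum_congr rfl fun n _ => integral_re_mul_exp _ _ _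
      · exact fun n _ => Continuous.intervalIntegrable (by fun_prop) _ _
    · exact fun n _ => Continuous.intervalIntegrable (by fun_prop) _ _
  rw [key, key]
  refine Finset.sum_le_sum fun m _ => Finset.sum_le_sum fun n _ =>
    mul_le_mul_of_nonneg_right ?_ (integral_cos_mul_sub_abs_nonneg _ hδ)
  refine (Complex.re_le_norm _).trans_eq ?_
  simp [hz, abs_of_nonneg (hc _)]

theorem tendsto_integral_sq_norm_mul {α : Type*} {f : Filter α} [f.IsCountablyGenerated]
    {F : α → ℝ → ℂ} {G : ℝ → ℂ} {C : ℝ} (hF : ∀ k, Continuous (F k))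
    (hC : ∀ k t, ‖F k t‖ ≤ C) (hlim : ∀ t, Tendsto (fun k => F k t) f (𝓝 (G t))) (δ : ℝ) :
    Tendsto (fun k => ∫ t in (-δ)..δ, ‖F k t‖ ^ 2 * (δ - |t|)) f
      (𝓝 (∫ t in (-δ)..δ, ‖G t‖ ^ 2 * (δ - |t|))) := by
  refine intervalIntegral.tendsto_integral_filter_of_dominated_convergence
    (fun t => C ^ 2 * ‖δ - |t|‖) ?_ ?_ ?_ ?_
  · exact Eventually.of_forall fun k =>
      Continuous.aestronglyMeasurable (by have := hF k; fun_prop)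
  · refine Eventually.of_forall fun k => Eventually.of_forall fun t _ => ?_
    rw [norm_mul, norm_pow, norm_norm]
    have := hC k t
    gcongr
  · exact Continuous.intervalIntegrable (by fun_prop) _ _
  · exact Eventually.of_forall fun t _ => ((hlim t).norm.pow 2).mul_const _

theorem norm_mul_mul_exp {c : ℝ} (hc : 0 ≤ c) {z : ℂ} (hz : ‖z‖ = 1) (x : ℝ) :
    ‖(c : ℂ) * z * cexp (x * I)‖ = c := by
  simp [hz, abs_of_nonneg hc, Complex.norm_exp_ofReal_mul_I]

theorem continuous_tsum_exp {ι : Type*} {c : ι → ℝ} (hc : ∀ n, 0 ≤ c n) (hs : Summable c)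
    {z : ι → ℂ} (hz : ∀ n, ‖z n‖ = 1) (l : ι → ℝ) :
    Continuous fun t : ℝ => ∑' n, (c n : ℂ) * z n * cexp ((l n * t : ℝ) * I) :=
  continuous_tsum (fun n => by fun_prop) hs fun n t => (norm_mul_mul_exp (hc n) (hz n) _).le

theorem integral_sq_norm_tsum_le {ι : Type*} [Countable ι] {c : ι → ℝ} (hc : ∀ n, 0 ≤ c n)
    (hs : Summable c) {z : ι → ℂ} (hz : ∀ n, ‖z n‖ = 1) (l : ι → ℝ) {δ : ℝ} (hδ : 0 < δ) :
    ∫ t in (-δ)..δ, ‖∑' n, (c n : ℂ) * z n * cexp ((l n * t : ℝ) * I)‖ ^ 2 * (δ - |t|) ≤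
      ∫ t in (-δ)..δ, ‖∑' n, (c n : ℂ) * cexp ((l n * t : ℝ) * I)‖ ^ 2 * (δ - |t|) := by
  have key : ∀ w : ι → ℂ, (∀ n, ‖w n‖ = 1) →
      Tendsto (fun S : Finset ι =>
        ∫ t in (-δ)..δ, ‖∑ n ∈ S, (c n : ℂ) * w n * cexp ((l n * t : ℝ) * I)‖ ^ 2 * (δ - |t|))
      atTop (𝓝
        (∫ t in (-δ)..δ, ‖∑' n, (c n : ℂ) * w n * cexp ((l n * t : ℝ) * I)‖ ^ 2 * (δ - |t|))) := by
    intro w hw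
    refine tendsto_integral_sq_norm_mul (C := ∑' n, c n) (fun S => by fun_prop) ?_ ?_ δ
    · intro S t
      refine (norm_sum_le_of_le S fun n _ => (norm_mul_mul_exp (hc n) (hw n) _).le).trans ?_
      exact hs.sum_le_tsum S fun n _ => hc n
    · intro t
      exact (Summable.of_norm_bounded hs fun n => (norm_mul_mul_exp (hc n) (hw n) _).le).hasSum
  have h1 := key (fun _ => 1) (by simp)
  simp only [mul_one] at h1
  exact le_of_tendsto_of_tendsto' (key z hz) h1 fun S => integral_sq_norm_sum_le S c hc z hz l hδ

theorem tendsto_integral_sq_norm_tsum {ι : Type*} {c : ι → ℝ} (hc : ∀ n, 0 ≤ c n)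
    (hs : Summable c) {z : ℕ → ι → ℂ} (hz : ∀ k n, ‖z k n‖ = 1)
    (hlim : ∀ n, Tendsto (fun k => z k n) atTop (𝓝 1)) (l : ι → ℝ) (δ : ℝ) :
    Tendsto (fun k => ∫ t in (-δ)..δ,
        ‖∑' n, (c n : ℂ) * z k n * cexp ((l n * t : ℝ) * I)‖ ^ 2 * (δ - |t|)) atTop
      (𝓝 (∫ t in (-δ)..δ, ‖∑' n, (c n : ℂ) * cexp ((l n * t : ℝ) * I)‖ ^ 2 * (δ - |t|))) := by
  refine tendsto_integral_sq_norm_mul (C := ∑' n, c n)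
    (fun k => continuous_tsum_exp hc hs (hz k) l) ?_ ?_ δ
  · exact fun k t => tsum_of_norm_bounded hs.hasSum
      fun n => (norm_mul_mul_exp (hc n) (hz k n) _).le
  · intro t
    refine tendsto_tsum_of_dominated_convergence hs (fun n => ?_)
      (Eventually.of_forall fun k n => (norm_mul_mul_exp (hc n) (hz k n) _).le)
    simpa using ((hlim n).const_mul (c n : ℂ)).mul_const (cexp ((l n * t : ℝ) * I))

/-- `f` is continuous with mean value `m` over the intervals `[X, 2 * X]` as `X → ∞`. -/
def HasMeanValue (f : ℝ → ℝ) (m : ℝ) : Prop :=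
  Continuous f ∧ Tendsto (fun X : ℝ => X⁻¹ * ∫ t in X..2 * X, f t) atTop (𝓝 m)

namespace HasMeanValue

theorem sum {ι : Type*} (S : Finset ι) {f : ι → ℝ → ℝ} {m : ι → ℝ}
    (h : ∀ i ∈ S, HasMeanValue (f i) (m i)) :
    HasMeanValue (fun t => ∑ i ∈ S, f i t) (∑ i ∈ S, m i) := by
  refine ⟨continuous_finsetSum S fun i hi => (h i hi).1, ?_⟩
  refine (tendsto_finsetSum S fun i hi => (h i hi).2).congr fun X => ?_
  rw [intervalIntegral.integral_finsetSum fun i hi => (h i hi).1.intervalIntegrable _ _,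
    Finset.mul_sum]

theorem const_mul {f : ℝ → ℝ} {m : ℝ} (h : HasMeanValue f m) (c : ℝ) :
    HasMeanValue (fun t => c * f t) (c * m) := by
  refine ⟨h.1.const_mul c, (h.2.const_mul c).congr fun X => ?_⟩
  rw [intervalIntegral.integral_const_mul]
  ring

theorem mono {f g : ℝ → ℝ} {m m' : ℝ} (hf : HasMeanValue f m) (hg : HasMeanValue g m') {T : ℝ}
    (hle : ∀ t, T ≤ t → f t ≤ g t) : m ≤ m' := by
  refine le_of_tendsto_of_tendsto hf.2 hg.2 ?_
  filter_upwards [eventually_ge_atTop T, eventually_gt_atTop 0] with X hX hX0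
  refine mul_le_mul_of_nonneg_left ?_ (inv_nonneg.2 hX0.le)
  exact intervalIntegral.integral_mono_on (by linarith) (hf.1.intervalIntegrable _ _)
    (hg.1.intervalIntegrable _ _) fun t ht => hle t (hX.trans ht.1)

end HasMeanValue

theorem hasMeanValue_re_mul_exp (w : ℂ) (x : ℝ) :
    HasMeanValue (fun t => (w * cexp ((x * t : ℝ) * I)).re) (if x = 0 then w.re else 0) := by
  refine ⟨by fun_prop, ?_⟩
  split_ifs with hx
  · subst hx
    refine tendsto_const_nhds.congr' ?_
    filter_upwards [eventually_gt_atTop 0] with X hX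
    simp
    field_simp
    ring
  · have hxI : (x : ℂ) * I ≠ 0 := by simp [hx]
    have hint : ∀ X : ℝ, ∫ t in X..2 * X, (w * cexp ((x * t : ℝ) * I)).re =
        (w * ((cexp ((x * (2 * X) : ℝ) * I) - cexp ((x * X : ℝ) * I)) / (x * I))).re := by
      intro X
      have h1 := intervalIntegral.intervalIntegral_re (𝕜 := ℂ) (μ := volume) (a := X) (b := 2 * X)
        (f := fun t : ℝ => w * cexp ((x * t : ℝ) * I))
        (Continuous.intervalIntegrable (by fun_prop) _ _)
      refine h1.trans ?_
      rw [intervalIntegral.integral_const_mul]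
      have h2 := integral_exp_mul_complex (a := X) (b := 2 * X) hxI
      have h3 : ∀ t : ℝ, ((x * t : ℝ) : ℂ) * I = x * I * t := fun t => by push_cast; ring
      simp_rw [h3, h2]
      rfl
    refine squeeze_zero_norm' (a := fun X : ℝ => X⁻¹ * (‖w‖ * (2 / |x|))) ?_ ?_
    · filter_upwards [eventually_gt_atTop 0] with X hX
      rw [norm_mul, norm_inv, Real.norm_of_nonneg hX.le, hint]
      refine mul_le_mul_of_nonneg_left ((Complex.abs_re_le_norm _).trans ?_) (inv_nonneg.2 hX.le)
      rw [norm_mul, norm_div, norm_mul, Complex.norm_I, mul_one, Complex.norm_real,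
        Real.norm_eq_abs]
      gcongr
      refine (norm_sub_le _ _).trans_eq ?_
      rw [Complex.norm_exp_ofReal_mul_I, Complex.norm_exp_ofReal_mul_I]
      norm_num
    · simpa using tendsto_inv_atTop_zero.mul_const (‖w‖ * (2 / |x|))

theorem tendsto_card_divisors_pow_ratio {P : ℕ} (hP : P ≠ 0) :
    Tendsto (fun k : ℕ => ((P ^ k).divisors.card : ℝ) / (P ^ (k + 1)).divisors.card) atTop
      (𝓝 1) := by
  have hcard : ∀ k : ℕ, ((P ^ k).divisors.card : ℝ) =
      ∏ p ∈ P.primeFactors, (1 + (P.factorization p : ℝ) * k) := by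
    intro k
    rcases eq_or_ne k 0 with rfl | hk
    · simp
    rw [Nat.card_divisors (pow_ne_zero k hP), Nat.primeFactors_pow P hk]
    push_cast
    refine Finset.prod_congr rfl fun p _ => ?_
    simp
    ring
  simp_rw [hcard, ← Finset.prod_div_distrib]
  have hlim : ∀ p ∈ P.primeFactors, Tendsto (fun k : ℕ => (1 + (P.factorization p : ℝ) * k) /
      (1 + (P.factorization p : ℝ) * (k + 1 : ℕ))) atTop (𝓝 1) := by
    intro p hp
    have hv : (P.factorization p : ℝ) ≠ 0 := by
      have := Nat.support_factorization P ▸ hp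
      exact_mod_cast Finsupp.mem_support_iff.1 this
    have := tendsto_add_mul_div_add_mul_atTop_nhds (1 : ℝ) (1 + (P.factorization p : ℝ))
      (P.factorization p : ℝ) hv
    rw [div_self hv] at this
    refine this.congr fun k => ?_
    push_cast
    ring_nf
  simpa only [Finset.prod_const_one] using tendsto_finsetProd P.primeFactors hlim

/-- The multiplicative semigroup `ℕ+` satisfies the Følner condition. -/
theorem PNat.exists_folner (A : Finset ℕ+) {ε : ℝ} (hε : 0 < ε) :
    ∃ S : Finset ℕ+, S.Nonempty ∧ ∀ n ∈ A,
      (1 - ε) * S.card ≤ ((S.filter fun r => n * r ∈ S).card : ℝ) := by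
  classical
  set P : ℕ+ := ∏ n ∈ A, n
  let D : ℕ → Finset ℕ+ := fun k => (((P : ℕ) ^ k).divisors).image Nat.toPNat'
  have hmem : ∀ k r, r ∈ D k ↔ r ∣ P ^ k := by
    intro k r
    simp only [D, Finset.mem_image, Nat.mem_divisors, PNat.dvd_iff, PNat.pow_coe]
    constructor
    · rintro ⟨d, ⟨hd, h0⟩, rfl⟩
      rwa [Nat.toPNat'_coe, if_pos (Nat.pos_of_dvd_of_pos hd (Nat.pos_of_ne_zero h0))]
    · exact fun h => ⟨r, ⟨h, pow_ne_zero k P.ne_zero⟩, PNat.coe_toPNat' r⟩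
  have hcard : ∀ k, (D k).card = ((P : ℕ) ^ k).divisors.card := by
    intro k
    refine Finset.card_image_of_injOn fun d hd e he h => ?_
    have hd0 := Nat.pos_of_mem_divisors hd
    have he0 := Nat.pos_of_mem_divisors he
    have := congrArg PNat.val h
    simpa [Nat.toPNat'_coe, hd0, he0] using this
  have hlim := tendsto_card_divisors_pow_ratio P.ne_zero
  obtain ⟨k, hk⟩ := (hlim.eventually (lt_mem_nhds (show 1 - ε < 1 by linarith))).exists
  have hne : (D (k + 1)).Nonempty := ⟨1, (hmem _ _).2 (one_dvd _)⟩
  refine ⟨D (k + 1), hne, fun n hn => ?_⟩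
  have hpos : (0 : ℝ) < (D (k + 1)).card := by exact_mod_cast hne.card_pos
  rw [← hcard, ← hcard, lt_div_iff₀ hpos] at hk
  refine hk.le.trans ?_
  have hsub : D k ⊆ (D (k + 1)).filter fun r => n * r ∈ D (k + 1) := by
    intro r hr
    rw [hmem] at hr
    rw [Finset.mem_filter, hmem, hmem]
    refine ⟨hr.trans (pow_dvd_pow P k.le_succ), ?_⟩
    rw [pow_succ']
    exact mul_dvd_mul (Finset.dvd_prod_of_mem _ hn) hr
  exact_mod_cast Finset.card_le_card hsub

section Recurrence

variable {b : ℕ+ → ℂ} {l : ℕ+ → ℝ}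

theorem hasMeanValue_sq_norm_mul_re (hb_mul : ∀ m n, b (m * n) = b m * b n)
    (hb_abs : ∀ n, ‖b n‖ = 1) (hl : Function.Injective l) (hl_mul : ∀ m n, l (m * n) = l m + l n)
    (S : Finset ℕ+) (n : ℕ+) :
    HasMeanValue (fun t => ‖∑ r ∈ S, b r * cexp ((l r * t : ℝ) * I)‖ ^ 2 *
      (b n * cexp ((l n * t : ℝ) * I)).re) ((S.filter fun r => n * r ∈ S).card : ℝ) := by
  have h := HasMeanValue.sum S fun r _ => HasMeanValue.sum S fun s _ =>
    hasMeanValue_re_mul_exp (b (n * r) * conj (b s)) (l (n * r) - l s)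
  convert h using 1
  · funext t
    have hsum : ∑ r ∈ S, ∑ s ∈ S,
        b (n * r) * conj (b s) * cexp (((l (n * r) - l s) * t : ℝ) * I) =
        ((‖∑ r ∈ S, b r * cexp ((l r * t : ℝ) * I)‖ ^ 2 : ℝ) : ℂ) *
          (b n * cexp ((l n * t : ℝ) * I)) := by
      rw [Complex.ofReal_pow, ← Complex.mul_conj', map_sum, Finset.sum_mul_sum, Finset.sum_mul]
      refine Finset.sum_congr rfl fun r _ => ?_
      rw [Finset.sum_mul]
      refine Finset.sum_congr rfl fun s _ => ?_
      have : (((l (n * r) - l s) * t : ℝ) : ℂ) * I =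
          (l n * t : ℝ) * I + ((l r * t : ℝ) * I + conj ((l s * t : ℝ) * I)) := by
        rw [hl_mul]
        simp only [map_mul, Complex.conj_I, Complex.conj_ofReal]
        push_cast
        ring
      rw [this, Complex.exp_add, Complex.exp_add, Complex.exp_conj, map_mul, hb_mul]
      ring
    rw [← Complex.re_ofReal_mul, ← hsum]
    simp only [Complex.re_sum]
  · have hval : ∀ r s, (if l (n * r) - l s = 0 then (b (n * r) * conj (b s)).re else 0) =
        if n * r = s then (1 : ℝ) else 0 := by
      intro r s
      simp only [sub_eq_zero, hl.eq_iff]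
      split_ifs with h
      · rw [h, Complex.mul_conj', hb_abs]
        simp
      · rfl
    simp_rw [hval]
    simp

theorem exists_ge_sum_re_gt (hb_one : b 1 = 1) (hb_mul : ∀ m n, b (m * n) = b m * b n)
    (hb_abs : ∀ n, ‖b n‖ = 1) (hl : Function.Injective l) (hl_mul : ∀ m n, l (m * n) = l m + l n)
    (A : Finset ℕ+) {η : ℝ} (hη : 0 < η) (T : ℝ) :
    ∃ t, T ≤ t ∧ A.card - η < ∑ n ∈ A, (b n * cexp ((l n * t : ℝ) * I)).re := by
  by_contra! hcon
  obtain ⟨S, hS, hfol⟩ := PNat.exists_folner A (ε := η / (A.card + 1)) (by positivity)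
  have hpos : (0 : ℝ) < S.card := by exact_mod_cast hS.card_pos
  have hl_one : l 1 = 0 := by simpa using hl_mul 1 1
  have hmean := hasMeanValue_sq_norm_mul_re hb_mul hb_abs hl hl_mul S
  have hW : HasMeanValue (fun t => ‖∑ r ∈ S, b r * cexp ((l r * t : ℝ) * I)‖ ^ 2) S.card := by
    have h1 := hmean 1
    simpa [hb_one, hl_one] using h1
  have hle := (HasMeanValue.sum A fun n _ => hmean n).mono (hW.const_mul (A.card - η)) (T := T)
    fun t ht => by
      rw [← Finset.mul_sum, mul_comm]
      exact mul_le_mul_of_nonneg_right (hcon t ht) (sq_nonneg _)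
  have hge := Finset.sum_le_sum hfol
  rw [Finset.sum_const, nsmul_eq_mul, ← mul_assoc] at hge
  have := le_of_mul_le_mul_right (hge.trans hle) hpos
  have hlt : A.card * (η / (A.card + 1)) < η := by
    rw [mul_div_assoc', div_lt_iff₀ (by positivity)]
    nlinarith
  linarith

theorem exists_seq_tendsto_one (hb_one : b 1 = 1) (hb_mul : ∀ m n, b (m * n) = b m * b n)
    (hb_abs : ∀ n, ‖b n‖ = 1) (hl : Function.Injective l)
    (hl_mul : ∀ m n, l (m * n) = l m + l n) :
    ∃ T : ℕ → ℝ, Tendsto T atTop atTop ∧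
      ∀ n, Tendsto (fun k => b n * cexp ((l n * T k : ℝ) * I)) atTop (𝓝 1) := by
  have hex : ∀ k : ℕ, ∃ t : ℝ, (k : ℝ) ≤ t ∧ _ := fun k =>
    exists_ge_sum_re_gt hb_one hb_mul hb_abs hl hl_mul (Finset.Icc 1 k.succPNat)
      (η := 1 / ((k : ℝ) + 1)) (by positivity) k
  choose T hT hsum using hex
  refine ⟨T, tendsto_atTop_mono hT tendsto_natCast_atTop_atTop, fun n => ?_⟩
  have hnorm : ∀ (m : ℕ+) (t : ℝ), ‖b m * cexp ((l m * t : ℝ) * I)‖ = 1 := fun m t => by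
    rw [norm_mul, hb_abs, Complex.norm_exp_ofReal_mul_I, one_mul]
  have hre : ∀ k : ℕ, n ≤ k.succPNat →
      1 - (b n * cexp ((l n * T k : ℝ) * I)).re ≤ 1 / ((k : ℝ) + 1) := by
    intro k hk
    have hsingle := Finset.single_le_sum (s := Finset.Icc 1 k.succPNat)
      (f := fun m => 1 - (b m * cexp ((l m * T k : ℝ) * I)).re)
      (fun m _ => sub_nonneg.2 ((Complex.re_le_norm _).trans (hnorm m _).le))
      (Finset.mem_Icc.2 ⟨one_le, hk⟩)
    rw [Finset.sum_sub_distrib, Finset.sum_const, nsmul_one] at hsingle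
    have := hsum k
    linarith
  rw [tendsto_iff_norm_sub_tendsto_zero]
  have hsq : ∀ k, ‖b n * cexp ((l n * T k : ℝ) * I) - 1‖ =
      √(2 * (1 - (b n * cexp ((l n * T k : ℝ) * I)).re)) := by
    intro k
    have h := Complex.sq_norm (b n * cexp ((l n * T k : ℝ) * I))
    rw [hnorm, Complex.normSq_apply] at h
    rw [Complex.norm_def, Complex.normSq_apply, Complex.sub_re, Complex.sub_im, Complex.one_re,
      Complex.one_im]
    congr 1
    linarith
  have hbound : Tendsto (fun k : ℕ => √(2 * (1 / ((k : ℝ) + 1)))) atTop (𝓝 0) := by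
    simpa using (tendsto_one_div_add_atTop_nhds_zero_nat (𝕜 := ℝ).const_mul 2).sqrt
  refine squeeze_zero' (Eventually.of_forall fun _ => norm_nonneg _) ?_ hbound
  filter_upwards [eventually_ge_atTop (n : ℕ)] with k hk
  rw [hsq]
  refine Real.sqrt_le_sqrt (mul_le_mul_of_nonneg_left (hre k ?_) zero_le_two)
  rw [← PNat.coe_le_coe, Nat.succPNat_coe]
  omega

end Recurrence

theorem stmt_4 (σ : ℝ) (a b : ℕ+ → ℂ)
    (hb_one : b 1 = 1)
    (hb_mul : ∀ m n : ℕ+, b (m * n) = b m * b n)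
    (hb_abs : ∀ n : ℕ+, ‖b n‖ = 1)
    (hab : ∀ n : ℕ+, a n = (‖a n‖ : ℂ) * b n)
    (hsum : Summable fun n : ℕ+ => ‖a n‖ * (n : ℝ) ^ (-σ))
    (L Lt : ℝ → ℂ)
    (hL : ∀ t : ℝ, L t = ∑' n : ℕ+, a n * (n : ℂ) ^ (-(σ + t * Complex.I)))
    (hLt : ∀ t : ℝ, Lt t = ∑' n : ℕ+, (‖a n‖ : ℂ) * (n : ℂ) ^ (-(σ + t * Complex.I)))
    (δ : ℝ) (hδ : 0 < δ) :
    Filter.limsup (fun T : ℝ =>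
        ((∫ t in (-δ)..δ, ‖L (T + t)‖ ^ 2 * (δ - |t|) : ℝ) : EReal)) Filter.atTop =
      ((∫ t in (-δ)..δ, ‖Lt t‖ ^ 2 * (δ - |t|) : ℝ) : EReal) ∧
    (⨆ T : ℝ, ((∫ t in (-δ)..δ, ‖L (T + t)‖ ^ 2 * (δ - |t|) : ℝ) : EReal)) =
      ((∫ t in (-δ)..δ, ‖Lt t‖ ^ 2 * (δ - |t|) : ℝ) : EReal) := by
  set l : ℕ+ → ℝ := fun n => -Real.log n with hl_def
  have hl : Function.Injective l := fun m n h =>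
    PNat.coe_injective <| Nat.cast_injective (R := ℝ) <|
      Real.log_injOn_pos (Set.mem_Ioi.2 (Nat.cast_pos.2 m.pos))
        (Set.mem_Ioi.2 (Nat.cast_pos.2 n.pos)) (neg_injective h)
  have hl_mul : ∀ m n, l (m * n) = l m + l n := by
    intro m n
    have hm : ((m : ℕ) : ℝ) ≠ 0 := Nat.cast_ne_zero.2 m.ne_zero
    have hn : ((n : ℕ) : ℝ) ≠ 0 := Nat.cast_ne_zero.2 n.ne_zero
    simp only [hl_def, PNat.mul_coe, Nat.cast_mul, Real.log_mul hm hn]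
    ring
  set c : ℕ+ → ℝ := fun n => ‖a n‖ * (n : ℝ) ^ (-σ)
  have hc : ∀ n, 0 ≤ c n := fun n => by positivity
  have hc_coe : ∀ n, (c n : ℂ) = ‖a n‖ * ((n : ℝ) ^ (-σ) : ℝ) := fun n => Complex.ofReal_mul _ _
  have hpow : ∀ (n : ℕ+) (t : ℝ), (n : ℂ) ^ (-(σ + t * I)) =
      ((n : ℝ) ^ (-σ) : ℝ) * cexp ((l n * t : ℝ) * I) := by
    intro n t
    have hn : ((n : ℕ) : ℂ) ≠ 0 := Nat.cast_ne_zero.2 n.ne_zero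
    rw [neg_add, Complex.cpow_add _ _ hn, Complex.ofReal_cpow (Nat.cast_nonneg _),
      Complex.ofReal_natCast, Complex.ofReal_neg,
      Complex.cpow_def_of_ne_zero hn (-(t * I)), Complex.natCast_log.symm]
    push_cast
    congr 2
    simp only [hl_def]
    push_cast
    ring
  have hLt' : ∀ t, Lt t = ∑' n, (c n : ℂ) * cexp ((l n * t : ℝ) * I) := by
    intro t
    rw [hLt]
    refine tsum_congr fun n => ?_
    rw [hpow, hc_coe]
    ring
  have hL' : ∀ T t, L (T + t) = ∑' n, (c n : ℂ) * (b n * cexp ((l n * T : ℝ) * I)) *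
      cexp ((l n * t : ℝ) * I) := by
    intro T t
    rw [hL]
    refine tsum_congr fun n => ?_
    have : ((l n * (T + t) : ℝ) : ℂ) * I = (l n * T : ℝ) * I + (l n * t : ℝ) * I := by
      push_cast
      ring
    rw [hpow, hab, this, Complex.exp_add, hc_coe]
    ring
  have hz : ∀ T n, ‖b n * cexp ((l n * T : ℝ) * I)‖ = 1 := fun T n => by
    rw [norm_mul, hb_abs, Complex.norm_exp_ofReal_mul_I, one_mul]
  simp_rw [hL', hLt']
  set F : ℝ → EReal := fun T => ((∫ t in (-δ)..δ,
    ‖∑' n, (c n : ℂ) * (b n * cexp ((l n * T : ℝ) * I)) * cexp ((l n * t : ℝ) * I)‖ ^ 2 *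
      (δ - |t|) : ℝ) : EReal)
  set J : EReal := ((∫ t in (-δ)..δ,
    ‖∑' n, (c n : ℂ) * cexp ((l n * t : ℝ) * I)‖ ^ 2 * (δ - |t|) : ℝ) : EReal)
  have hsup : ⨆ T, F T ≤ J := iSup_le fun T =>
    EReal.coe_le_coe_iff.2 (integral_sq_norm_tsum_le hc hsum (hz T) l hδ)
  obtain ⟨T, hT, hone⟩ := exists_seq_tendsto_one hb_one hb_mul hb_abs hl hl_mul
  have hlim : Tendsto (fun k => F (T k)) atTop (𝓝 J) :=
    (continuous_coe_real_ereal.tendsto _).comp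
      (tendsto_integral_sq_norm_tsum hc hsum (fun k => hz (T k)) hone l δ)
  have hlimsup : J ≤ limsup F atTop := by
    rw [← hlim.limsup_eq]
    exact limsup_le_limsup_of_le (u := F) hT
  exact ⟨le_antisymm (limsup_le_iSup.trans hsup) hlimsup,
    le_antisymm hsup (hlimsup.trans limsup_le_iSup)⟩
end
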